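/- Let 𝒜 be an elliptic homogeneous constant-coefficient differential operator of order k on ℝ^n. Then 𝒜 is canceling if and only if, whenever the equation 𝒜u = δ_0 w (δ_0 the Dirac mass at the origin) has a solution u ∈ BV^𝒜_loc(ℝ^n) for some w ∈ W, necessarily w = 0. Moreover, if 𝒜 is elliptic and non-canceling, the equation 𝒜u = δ_0 w with w ≠ 0 has a solution u_h that is smooth on ℝ^n \ {0} and such that D^l u_h is (k−n−l)-homogeneous for all integers l ≥ max{0, k−n+1}. -/

import Mathlib

open MeasureTheory Metric Filter
open scoped ENNReal RealInnerProductSpace Topology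

noncomputable section

/-- Euclidean space `ℝ^n`. -/
abbrev Euc (n : ℕ) : Type := EuclideanSpace ℝ (Fin n)

/-- The `i`-th standard basis vector of `ℝ^n`. -/
def stdVec (n : ℕ) (i : Fin n) : Euc n := EuclideanSpace.single i (1 : ℝ)

/-- Coefficients `A_I : V →ₗ W` (indexed by `I : Fin k → Fin n`) of a homogeneous linear
constant-coefficient differential operator `𝒜 u = ∑_I A_I ∂_I u` of order `k` on `ℝ^n`. -/
abbrev CoeffOp (n k : ℕ) (V W : Type*) [NormedAddCommGroup V] [InnerProductSpace ℝ V]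
    [NormedAddCommGroup W] [InnerProductSpace ℝ W] : Type _ :=
  (Fin k → Fin n) → (V →ₗ[ℝ] W)

variable {V W F : Type*}
  [NormedAddCommGroup V] [InnerProductSpace ℝ V] [FiniteDimensional ℝ V]
  [NormedAddCommGroup W] [InnerProductSpace ℝ W] [FiniteDimensional ℝ W]

/-- The coefficients represent a linear map on symmetric tensors `V ⊙^k ℝ^n`. -/
def IsSymmetricOp (n k : ℕ) (A : CoeffOp n k V W) : Prop :=
  ∀ (I : Fin k → Fin n) (σ : Equiv.Perm (Fin k)), A (I ∘ σ) = A I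

/-- The symbol `𝒜[ξ] v = A (v ⊗^k ξ) = ∑_I (∏ i, ξ_{I i}) A_I v`. -/
def symbolMap (n k : ℕ) (A : CoeffOp n k V W) (ξ : Euc n) : V →ₗ[ℝ] W :=
  ∑ I : Fin k → Fin n, (∏ i, ξ (I i)) • A I

/-- Ellipticity: the symbol is injective for all `ξ ≠ 0`. -/
def IsElliptic (n k : ℕ) (A : CoeffOp n k V W) : Prop :=
  ∀ ξ : Euc n, ξ ≠ 0 → Function.Injective (symbolMap n k A ξ)

/-- Van Schaftingen's cancellation condition: `⋂_{ξ ∈ 𝕊^{n-1}} im 𝒜[ξ] = {0}`. -/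
def IsCanceling (n k : ℕ) (A : CoeffOp n k V W) : Prop :=
  (⋂ ξ ∈ sphere (0 : Euc n) 1, (LinearMap.range (symbolMap n k A ξ) : Set W)) = {0}

/-- Inverse of an endomorphism (junk value when not invertible), via matrix inversion. -/
def linInv (f : V →ₗ[ℝ] V) : V →ₗ[ℝ] V :=
  letI b := Module.finBasis ℝ V
  Matrix.toLin b b ((LinearMap.toMatrix b b f)⁻¹)

/-- `𝒜†[ξ] = (𝒜*[ξ] 𝒜[ξ])⁻¹ 𝒜*[ξ]`. -/
def Adagger (n k : ℕ) (A : CoeffOp n k V W) (ξ : Euc n) : W →ₗ[ℝ] V :=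
  linInv (LinearMap.adjoint (symbolMap n k A ξ) ∘ₗ symbolMap n k A ξ) ∘ₗ
    LinearMap.adjoint (symbolMap n k A ξ)

/-- Condition (WC): for every `w ∈ ⋂_{ξ ∈ 𝕊^{n-1}} im 𝒜[ξ]`,
`∫_{𝕊^{n-1}} 𝒜†[ξ] w ⊗^{k-n} ξ dℋ^{n-1}(ξ) = 0`, written componentwise in the
tensor coordinates indexed by `J : Fin (k-n) → Fin n`. -/
def IsWeaklyCanceling (n k : ℕ) (A : CoeffOp n k V W) : Prop :=
  ∀ w : W, (∀ ξ ∈ sphere (0 : Euc n) 1, w ∈ LinearMap.range (symbolMap n k A ξ)) →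
    ∀ J : Fin (k - n) → Fin n,
      (∫ ξ in sphere (0 : Euc n) 1,
        (∏ i, ξ (J i)) • (Adagger n k A ξ w) ∂(μH[(n : ℝ) - 1])) = 0

section TestFun

variable [NormedAddCommGroup F] [NormedSpace ℝ F]

/-- Compactly supported smooth test function. -/
def IsTestFun (n : ℕ) (φ : Euc n → F) : Prop :=
  ContDiff ℝ (⊤ : ℕ∞) φ ∧ HasCompactSupport φ

/-- Iterated directional derivative `∂_{I 0} ⋯ ∂_{I (m-1)} φ (x)`. -/
def dirDeriv (n m : ℕ) (I : Fin m → Fin n) (φ : Euc n → F) (x : Euc n) : F :=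
  iteratedFDeriv ℝ m φ x (fun i => stdVec n (I i))

/-- Smooth functions of degree-`≤ j` polynomial type. -/
def IsPolyDeg (n : ℕ) (j : ℕ) (P : Euc n → F) : Prop :=
  ContDiff ℝ (⊤ : ℕ∞) P ∧ ∀ x, iteratedFDeriv ℝ (j + 1) P x = 0

end TestFun

/-- Pointwise application of the operator `𝒜` to a smooth map. -/
def Aapply (n k : ℕ) (A : CoeffOp n k V W) (u : Euc n → V) (x : Euc n) : W :=
  ∑ I : Fin k → Fin n, A I (dirDeriv n k I u x)

/-- `𝒜 u = f σ` (a `W`-valued measure with total-variation measure `σ` and polar density `f`)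
in the sense of distributions. -/
def HasDistribA (n k : ℕ) (A : CoeffOp n k V W) (u : Euc n → V) (σ : Measure (Euc n))
    (f : Euc n → W) : Prop :=
  ∀ φ : Euc n → W, IsTestFun n φ →
    ((-1 : ℝ) ^ k) * (∑ I : Fin k → Fin n,
        ∫ x, ⟪u x, LinearMap.adjoint (A I) (dirDeriv n k I φ x)⟫) =
      ∫ x, ⟪f x, φ x⟫ ∂σ

/-- `u ∈ BV^𝒜_loc(ℝ^n)`: `u` is locally integrable and `𝒜 u` is a `W`-valued Radon measure,
given by its polar decomposition `f σ` with `σ` locally finite and `‖f‖ = 1` σ-a.e. -/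
def MemBVAloc (n k : ℕ) (A : CoeffOp n k V W) (u : Euc n → V) : Prop :=
  LocallyIntegrable u volume ∧
    ∃ (σ : Measure (Euc n)) (f : Euc n → W), IsLocallyFiniteMeasure σ ∧
      LocallyIntegrable f σ ∧ (∀ᵐ x ∂σ, ‖f x‖ = 1) ∧ HasDistribA n k A u σ f

/-- `v` is the family of weak derivatives of order `m` of `u` (componentwise, indexed by
`I : Fin m → Fin n`). -/
def IsWeakDerivFamily (n m : ℕ) (u : Euc n → V) (v : (Fin m → Fin n) → Euc n → V) : Prop :=
  (∀ I, LocallyIntegrable (v I) volume) ∧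
    ∀ (I : Fin m → Fin n) (φ : Euc n → ℝ), IsTestFun n φ →
      ∫ x, (dirDeriv n m I φ x) • u x = ((-1 : ℝ) ^ m) • ∫ x, φ x • v I x

/-- `Q r = o(r^a)` as `r ↓ 0`. -/
def SmallO (Q : ℝ → ℝ≥0∞) (a : ℝ) : Prop :=
  Tendsto (fun r => Q r / ENNReal.ofReal (r ^ a)) (𝓝[>] (0 : ℝ)) (𝓝 0)

section Spaces

variable [NormedAddCommGroup F] [NormedSpace ℝ F]

/-- `f ∈ t^{j,p}(x)`: there is a polynomial `P` of degree at most `j` with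
`(⨍_{B_r(x)} |f - P|^p)^{1/p} = o(r^j)` as `r ↓ 0`. -/
def MemT (n : ℕ) (j : ℕ) (p : ℝ) (f : Euc n → F) (x : Euc n) : Prop :=
  ∃ P : Euc n → F, IsPolyDeg n j P ∧
    SmallO (fun r => ((volume (ball x r))⁻¹ *
      ∫⁻ y in ball x r, (‖f y - P y‖₊ : ℝ≥0∞) ^ p) ^ (1 / p)) (j : ℝ)

/-- `f ∈ t^{j,∞}(x)`: there is a polynomial `P` of degree at most `j` with
`‖f - P‖_{L^∞(B_r(x))} = o(r^j)` as `r ↓ 0`. -/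
def MemTInf (n : ℕ) (j : ℕ) (f : Euc n → F) (x : Euc n) : Prop :=
  ∃ P : Euc n → F, IsPolyDeg n j P ∧
    SmallO (fun r => essSup (fun y => (‖f y - P y‖₊ : ℝ≥0∞))
      (volume.restrict (ball x r))) (j : ℝ)

/-- The Lorentz `L^{p,q}` quasi-norm (for `p, q < ∞`). -/
def lorentzNorm {α : Type*} [MeasurableSpace α] (p q : ℝ) (μ : Measure α) (f : α → F) : ℝ≥0∞ :=
  ENNReal.ofReal p ^ (1 / q) *
    (∫⁻ t in Set.Ioi (0 : ℝ),
      (ENNReal.ofReal t * (μ {x | t < ‖f x‖}) ^ (1 / p)) ^ q * (ENNReal.ofReal t)⁻¹) ^ (1 / q)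

/-- `f` is `L^{p,q}`-differentiable of order `j` at `x`:
`‖f - P‖_{L^{p,q}(B_r(x))} = o(r^{j + n/p})` for a polynomial `P` of degree at most `j`. -/
def MemTLorentz (n : ℕ) (j : ℕ) (p q : ℝ) (f : Euc n → F) (x : Euc n) : Prop :=
  ∃ P : Euc n → F, IsPolyDeg n j P ∧
    SmallO (fun r => lorentzNorm p q (volume.restrict (ball x r)) (fun y => f y - P y))
      ((j : ℝ) + n / p)

/-- `f ∈ L^p_loc`. -/
def LocLp (n : ℕ) (p : ℝ) (f : Euc n → F) : Prop :=
  ∀ K : Set (Euc n), IsCompact K → ∫⁻ x in K, (‖f x‖₊ : ℝ≥0∞) ^ p < ⊤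

end Spaces

end

/-- `𝒜 u = δ₀ w` in the sense of distributions. -/
def HasDistribADirac (n k : ℕ) {V W : Type*}
    [NormedAddCommGroup V] [InnerProductSpace ℝ V] [FiniteDimensional ℝ V]
    [NormedAddCommGroup W] [InnerProductSpace ℝ W] [FiniteDimensional ℝ W]
    (A : CoeffOp n k V W) (u : Euc n → V) (w : W) : Prop :=
  ∀ φ : Euc n → W, IsTestFun n φ →
    ((-1 : ℝ) ^ k) * (∑ I : Fin k → Fin n,
        ∫ x, ⟪u x, LinearMap.adjoint (A I) (dirDeriv n k I φ x)⟫) = ⟪w, φ 0⟫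

open scoped SchwartzMap LineDeriv ContDiff

section DiffOp

/-- The partial derivative `∂_i` as an endomorphism of the Schwartz space. -/
noncomputable def partialDeriv (n : ℕ) (i : Fin n) : Module.End ℝ 𝓢(Euc n, ℝ) :=
  (LineDeriv.lineDerivOpCLM ℝ 𝓢(Euc n, ℝ) (stdVec n i)).toLinearMap

theorem partialDeriv_apply (n : ℕ) (i : Fin n) (ψ : 𝓢(Euc n, ℝ)) :
    partialDeriv n i ψ = ∂_{stdVec n i} ψ := rfl

theorem SchwartzMap.lineDerivOp_comm {E F : Type*} [NormedAddCommGroup E] [NormedSpace ℝ E]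
    [NormedAddCommGroup F] [NormedSpace ℝ F] (v w : E) (ψ : 𝓢(E, F)) :
    ∂_{v} (∂_{w} ψ) = ∂_{w} (∂_{v} ψ) := by
  ext x
  have h : ∀ a b : E, ∂_{a} (∂_{b} ψ) x = fderiv ℝ (fderiv ℝ ψ) x a b := fun a b => by
    rw [SchwartzMap.lineDerivOp_apply_eq_fderiv]
    have h1 : ⇑(∂_{b} ψ : 𝓢(E, F)) = fun y => fderiv ℝ ψ y b := rfl
    rw [h1, fderiv_clm_apply (((ψ.smooth 2).fderiv_right (m := 1)
      (le_of_eq one_add_one_eq_two)).differentiable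
      (by simp) x) (differentiableAt_const b)]
    simp
  rw [h, h]
  exact (ψ.contDiffAt 2).isSymmSndFDerivAt (by simp) v w

theorem partialDeriv_comm (n : ℕ) : ∀ a ∈ Set.range (partialDeriv n),
    ∀ b ∈ Set.range (partialDeriv n), a * b = b * a := by
  rintro _ ⟨i, rfl⟩ _ ⟨j, rfl⟩
  ext1 ψ
  exact SchwartzMap.lineDerivOp_comm _ _ ψ

open scoped IsMulCommutative in
/-- The scalar constant-coefficient differential operator `q(∂)` acting on Schwartz functions. -/
noncomputable def diffOp (n : ℕ) : MvPolynomial (Fin n) ℝ →ₐ[ℝ] Module.End ℝ 𝓢(Euc n, ℝ) :=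
  haveI : IsMulCommutative (Algebra.adjoin ℝ (Set.range (partialDeriv n))) :=
    Algebra.isMulCommutative_adjoin ℝ (partialDeriv_comm n)
  (Algebra.adjoin ℝ (Set.range (partialDeriv n))).val.comp
    (MvPolynomial.aeval fun i =>
      (⟨partialDeriv n i, Algebra.subset_adjoin (Set.mem_range_self i)⟩ :
        Algebra.adjoin ℝ (Set.range (partialDeriv n))))

theorem diffOp_X (n : ℕ) (i : Fin n) : diffOp n (MvPolynomial.X i) = partialDeriv n i := by
  simp [diffOp]

theorem diffOp_C (n : ℕ) (c : ℝ) (ψ : 𝓢(Euc n, ℝ)) :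
    diffOp n (MvPolynomial.C c) ψ = c • ψ := by
  rw [← MvPolynomial.algebraMap_eq, AlgHom.commutes]
  simp

theorem diffOp_mul (n : ℕ) (p q : MvPolynomial (Fin n) ℝ) (ψ : 𝓢(Euc n, ℝ)) :
    diffOp n (p * q) ψ = diffOp n p (diffOp n q ψ) := by
  rw [map_mul, Module.End.mul_apply]

theorem diffOp_monomial (n m : ℕ) (I : Fin m → Fin n) (ψ : 𝓢(Euc n, ℝ)) (x : Euc n) :
    diffOp n (∏ i, MvPolynomial.X (I i)) ψ x = dirDeriv n m I ψ x := by
  rw [dirDeriv, ← SchwartzMap.iteratedLineDerivOp_eq_iteratedFDeriv]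
  congr 1
  induction m with
  | zero => simp
  | succ m ih =>
    rw [Fin.prod_univ_succ, diffOp_mul, ih (fun i => I i.succ), diffOp_X, partialDeriv_apply,
      LineDeriv.iteratedLineDerivOp_succ_left]
    rfl

theorem tsupport_diffOp_subset (n : ℕ) (q : MvPolynomial (Fin n) ℝ) (ψ : 𝓢(Euc n, ℝ)) :
    tsupport (diffOp n q ψ) ⊆ tsupport ψ := by
  induction q using MvPolynomial.induction_on generalizing ψ with
  | C a =>
    rw [diffOp_C]
    exact closure_mono (Function.support_const_smul_subset a ψ)
  | add p q hp hq =>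
    rw [map_add, LinearMap.add_apply]
    exact (tsupport_add _ _).trans (Set.union_subset (hp ψ) (hq ψ))
  | mul_X p i hp =>
    rw [diffOp_mul, diffOp_X]
    exact (hp _).trans (SchwartzMap.tsupport_lineDerivOp_subset _ ψ)

theorem diffOp_eventuallyEq_exp (n : ℕ) (q : MvPolynomial (Fin n) ℝ) (ξ : Euc n) (c : ℝ)
    (ψ : 𝓢(Euc n, ℝ)) (hψ : ψ =ᶠ[𝓝 0] fun x => c * Real.exp ⟪ξ, x⟫) :
    diffOp n q ψ =ᶠ[𝓝 0] fun x => c * q.eval (fun i => ξ i) * Real.exp ⟪ξ, x⟫ := by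
  induction q using MvPolynomial.induction_on generalizing ψ c with
  | C a =>
    rw [diffOp_C]
    filter_upwards [hψ] with x hx
    simp [hx]; ring
  | add p q hp hq =>
    rw [map_add, LinearMap.add_apply]
    filter_upwards [hp c ψ hψ, hq c ψ hψ] with x h1 h2
    simp [h1, h2]; ring
  | mul_X p i hp =>
    rw [diffOp_mul, diffOp_X]
    have h : partialDeriv n i ψ =ᶠ[𝓝 0] fun x => (c * ξ i) * Real.exp ⟪ξ, x⟫ := by
      filter_upwards [hψ.eventuallyEq_nhds] with x hx
      rw [partialDeriv_apply, SchwartzMap.lineDerivOp_apply_eq_fderiv, hx.fderiv_eq]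
      have h1 : HasFDerivAt (fun x : Euc n => c * Real.exp ⟪ξ, x⟫)
          (c • (Real.exp ⟪ξ, x⟫ • innerSL ℝ ξ)) x :=
        ((innerSL ℝ ξ).hasFDerivAt.exp).const_mul c
      rw [h1.fderiv]
      simp [stdVec, EuclideanSpace.inner_single_right]; ring
    filter_upwards [hp _ _ h] with x hx
    rw [hx]; simp; ring

end DiffOp

section Necessity

variable {V W : Type*}
  [NormedAddCommGroup V] [InnerProductSpace ℝ V] [FiniteDimensional ℝ V]
  [NormedAddCommGroup W] [InnerProductSpace ℝ W] [FiniteDimensional ℝ W]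

/-- The symbol of `A` as a matrix of polynomials, in orthonormal coordinates of `V` and `W`. -/
noncomputable def symbolMatrix (n k : ℕ) (A : CoeffOp n k V W) :
    Matrix (Fin (Module.finrank ℝ W)) (Fin (Module.finrank ℝ V)) (MvPolynomial (Fin n) ℝ) :=
  fun j l => ∑ I : Fin k → Fin n,
    MvPolynomial.C ⟪stdOrthonormalBasis ℝ W j, A I (stdOrthonormalBasis ℝ V l)⟫ *
      ∏ i, MvPolynomial.X (I i)

/-- The numeric matrix of the symbol at the covector `ξ`. -/
noncomputable def symbolMatrixEval (n k : ℕ) (A : CoeffOp n k V W) (ξ : Euc n) :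
    Matrix (Fin (Module.finrank ℝ W)) (Fin (Module.finrank ℝ V)) ℝ :=
  (symbolMatrix n k A).map (MvPolynomial.eval fun i => ξ i)

theorem symbolMatrixEval_apply (n k : ℕ) (A : CoeffOp n k V W) (ξ : Euc n) (j l) :
    symbolMatrixEval n k A ξ j l =
      ⟪stdOrthonormalBasis ℝ W j, symbolMap n k A ξ (stdOrthonormalBasis ℝ V l)⟫ := by
  simp [symbolMatrixEval, symbolMatrix, symbolMap, LinearMap.sum_apply, inner_sum,
    inner_smul_right, mul_comm]

theorem symbolMatrixEval_mulVec (n k : ℕ) (A : CoeffOp n k V W) (ξ : Euc n)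
    (c : Fin (Module.finrank ℝ V) → ℝ) (j) :
    (symbolMatrixEval n k A ξ).mulVec c j =
      ⟪stdOrthonormalBasis ℝ W j,
        symbolMap n k A ξ (∑ l, c l • stdOrthonormalBasis ℝ V l)⟫ := by
  simp [Matrix.mulVec, dotProduct, symbolMatrixEval_apply, map_sum, inner_sum,
    inner_smul_right, mul_comm]

/-- The determinant of `𝒜*[ξ] 𝒜[ξ]`, as a polynomial. -/
noncomputable def gramDet (n k : ℕ) (A : CoeffOp n k V W) : MvPolynomial (Fin n) ℝ :=
  ((symbolMatrix n k A).transpose * symbolMatrix n k A).det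

theorem eval_gramDet (n k : ℕ) (A : CoeffOp n k V W) (ξ : Euc n) :
    (gramDet n k A).eval (fun i => ξ i) =
      ((symbolMatrixEval n k A ξ).transpose * symbolMatrixEval n k A ξ).det := by
  rw [gramDet, RingHom.map_det, RingHom.mapMatrix_apply, Matrix.map_mul, symbolMatrixEval,
    Matrix.transpose_map]

theorem eval_gramDet_ne_zero (n k : ℕ) (A : CoeffOp n k V W) (hell : IsElliptic n k A)
    (ξ : Euc n) (hξ : ξ ≠ 0) : (gramDet n k A).eval (fun i => ξ i) ≠ 0 := by
  rw [eval_gramDet, ← isUnit_iff_ne_zero, ← Matrix.isUnit_iff_isUnit_det,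
    ← Matrix.mulVec_injective_iff_isUnit]
  refine (injective_iff_map_eq_zero
    (Matrix.mulVecLin ((symbolMatrixEval n k A ξ).transpose * symbolMatrixEval n k A ξ))).2 ?_
  intro c hc
  have h0 : (symbolMatrixEval n k A ξ).mulVec c = 0 := by
    have h1 : dotProduct c (((symbolMatrixEval n k A ξ).transpose *
        symbolMatrixEval n k A ξ).mulVec c) = 0 := by
      rw [Matrix.mulVecLin_apply] at hc
      rw [hc, dotProduct_zero]
    rw [← Matrix.mulVec_mulVec, Matrix.dotProduct_mulVec, Matrix.vecMul_transpose] at h1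
    exact dotProduct_self_eq_zero.1 h1
  have h2 : symbolMap n k A ξ (∑ l, c l • stdOrthonormalBasis ℝ V l) = 0 := by
    refine InnerProductSpace.ext_inner_left_basis (stdOrthonormalBasis ℝ W).toBasis fun j => ?_
    have := congrFun h0 j
    rw [symbolMatrixEval_mulVec] at this
    simpa using this
  have h3 := (injective_iff_map_eq_zero _).1 (hell ξ hξ) _ h2
  funext l
  exact (Fintype.linearIndependent_iff.1
    (stdOrthonormalBasis ℝ V).toBasis.linearIndependent c (by simpa using h3)) l

/-- `p - 𝒜 adj(𝒜*𝒜) 𝒜*` with `p = det(𝒜*𝒜)`: a polynomial matrix annihilated by `𝒜*` on the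
left. -/
noncomputable def annihilator (n k : ℕ) (A : CoeffOp n k V W) :
    Matrix (Fin (Module.finrank ℝ W)) (Fin (Module.finrank ℝ W)) (MvPolynomial (Fin n) ℝ) :=
  gramDet n k A • (1 : Matrix _ _ _) - symbolMatrix n k A *
    ((symbolMatrix n k A).transpose * symbolMatrix n k A).adjugate *
      (symbolMatrix n k A).transpose

theorem transpose_symbolMatrix_mul_annihilator (n k : ℕ) (A : CoeffOp n k V W) :
    (symbolMatrix n k A).transpose * annihilator n k A = 0 := by
  rw [annihilator, Matrix.mul_sub, ← Matrix.mul_assoc, ← Matrix.mul_assoc, Matrix.mul_adjugate,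
    gramDet]
  simp

theorem eval_annihilator_mulVec (n k : ℕ) (A : CoeffOp n k V W) (ξ : Euc n)
    (c : Fin (Module.finrank ℝ W) → ℝ) (hc : (symbolMatrixEval n k A ξ).transpose.mulVec c = 0) :
    ((annihilator n k A).map (MvPolynomial.eval fun i => ξ i)).mulVec c =
      (gramDet n k A).eval (fun i => ξ i) • c := by
  have h : (annihilator n k A).map (MvPolynomial.eval fun i => ξ i) =
      (gramDet n k A).eval (fun i => ξ i) • (1 : Matrix _ _ ℝ) - symbolMatrixEval n k A ξ *
        (((symbolMatrix n k A).transpose * symbolMatrix n k A).adjugate.map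
          (MvPolynomial.eval fun i => ξ i)) * (symbolMatrixEval n k A ξ).transpose := by
    rw [annihilator, Matrix.map_sub (f := MvPolynomial.eval fun i => ξ i) (map_sub _),
      Matrix.map_mul, Matrix.map_mul]
    congr 1
    ext i j
    by_cases hij : i = j <;> simp [hij]
  rw [h, Matrix.sub_mulVec, ← Matrix.mulVec_mulVec, hc, Matrix.mulVec_zero, sub_zero,
    Matrix.smul_mulVec, Matrix.one_mulVec]

theorem dirDeriv_sum_smul {F : Type*} [NormedAddCommGroup F] [NormedSpace ℝ F] {ι : Type*}
    (s : Finset ι) (n m : ℕ) (I : Fin m → Fin n) (f : ι → Euc n → ℝ)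
    (hf : ∀ i, ContDiff ℝ ∞ (f i)) (b : ι → F) (x : Euc n) :
    dirDeriv n m I (fun y => ∑ i ∈ s, f i y • b i) x = ∑ i ∈ s, dirDeriv n m I (f i) x • b i := by
  unfold dirDeriv
  have h1 : ∀ i, ContDiff ℝ m (f i) := fun i => (hf i).of_le (mod_cast le_top)
  rw [iteratedFDeriv_fun_sum_apply (f := fun i y => f i y • b i)
    (fun i _ => ((h1 i).smul contDiff_const).contDiffAt)]
  simp only [sum_apply]
  refine Finset.sum_congr rfl fun i _ => ?_
  rw [iteratedFDeriv_smul_const_apply (h1 i).contDiffAt]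
  simp

theorem exists_schwartz_eventuallyEq_exp (n : ℕ) (ξ : Euc n) :
    ∃ ψ : 𝓢(Euc n, ℝ), HasCompactSupport ψ ∧ ψ =ᶠ[𝓝 0] fun x => 1 * Real.exp ⟪ξ, x⟫ := by
  let ρ : ContDiffBump (0 : Euc n) := ⟨1, 2, one_pos, one_lt_two⟩
  have h1 : HasCompactSupport fun x => ρ x * Real.exp ⟪ξ, x⟫ := ρ.hasCompactSupport.mul_right
  have h2 : ContDiff ℝ ∞ fun x => ρ x * Real.exp ⟪ξ, x⟫ :=
    ρ.contDiff.mul (innerSL ℝ ξ).contDiff.exp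
  refine ⟨h1.toSchwartzMap h2, h1, ?_⟩
  filter_upwards [ρ.eventuallyEq_one] with x hx
  change ρ x * Real.exp ⟪ξ, x⟫ = _
  rw [hx, Pi.one_apply]

theorem LocallyIntegrable.integrable_inner {n : ℕ} {u g : Euc n → V}
    (hu : LocallyIntegrable u volume) (hg : Continuous g) (hc : HasCompactSupport g) :
    Integrable (fun x => ⟪u x, g x⟫) volume := by
  have h1 : Integrable (fun x => ‖g x‖ • u x) volume :=
    hu.integrable_smul_left_of_hasCompactSupport hg.norm hc.norm
  refine h1.mono (hu.aestronglyMeasurable.inner hg.aestronglyMeasurable) (ae_of_all _ fun x => ?_)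
  rw [norm_smul, norm_norm, mul_comm]
  exact norm_inner_le_norm _ _

theorem IsTestFun.dirDeriv {F : Type*} [NormedAddCommGroup F] [NormedSpace ℝ F] {n : ℕ}
    {φ : Euc n → F} (hφ : IsTestFun n φ) (m : ℕ) (I : Fin m → Fin n) :
    IsTestFun n (dirDeriv n m I φ) := by
  refine ⟨?_, ?_⟩
  · have h := hφ.1.iteratedFDeriv_right (m := ∞) (i := m) (by exact_mod_cast le_top)
    exact (ContinuousMultilinearMap.apply ℝ (fun _ : Fin m => Euc n) F
      (fun i => stdVec n (I i))).contDiff.comp h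
  · exact (hφ.2.iteratedFDeriv (𝕜 := ℝ) m).comp_left (g := fun M => M fun i => stdVec n (I i)) rfl

theorem HasDistribADirac.mem_range_symbolMap {n k : ℕ} {A : CoeffOp n k V W}
    (hell : IsElliptic n k A) {u : Euc n → V} (hu : LocallyIntegrable u volume) {w : W}
    (h : HasDistribADirac n k A u w) {ξ : Euc n} (hξ : ξ ≠ 0) :
    w ∈ LinearMap.range (symbolMap n k A ξ) := by
  rw [← Submodule.orthogonal_orthogonal (LinearMap.range (symbolMap n k A ξ)),
    Submodule.mem_orthogonal']
  intro η hη
  let bV := stdOrthonormalBasis ℝ V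
  let bW := stdOrthonormalBasis ℝ W
  let c : Fin (Module.finrank ℝ W) → ℝ := fun j => ⟪bW j, η⟫
  have hc : (symbolMatrixEval n k A ξ).transpose.mulVec c = 0 := by
    funext l
    simp only [Matrix.mulVec, dotProduct, Matrix.transpose_apply, symbolMatrixEval_apply]
    have := bW.sum_inner_mul_inner (symbolMap n k A ξ (bV l)) η
    rw [(Submodule.mem_orthogonal _ _).1 hη _ (LinearMap.mem_range_self _ _)] at this
    simpa [c, bW, bV, real_inner_comm] using this
  obtain ⟨ψ, hψc, hψ⟩ := exists_schwartz_eventuallyEq_exp n ξ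
  let f : Fin (Module.finrank ℝ W) → 𝓢(Euc n, ℝ) := fun j =>
    ∑ l, c l • diffOp n (annihilator n k A j l) ψ
  let φ : Euc n → W := fun x => ∑ j, f j x • bW j
  have hfc : ∀ j, HasCompactSupport (f j) := fun j => by
    refine hψc.mono' ?_
    intro x hx
    by_contra hx'
    apply hx
    simp only [f, sum_apply, smul_apply]
    refine Finset.sum_eq_zero fun l _ => ?_
    rw [image_eq_zero_of_notMem_tsupport
      (fun h' => hx' (tsupport_diffOp_subset n _ ψ h')), smul_zero]
  have hφ : IsTestFun n φ := by
    refine ⟨ContDiff.sum fun j _ => ((f j).smooth ⊤).smul contDiff_const, ?_⟩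
    have : ∀ s : Finset (Fin (Module.finrank ℝ W)),
        HasCompactSupport fun x => ∑ j ∈ s, f j x • bW j := by
      intro s
      induction s using Finset.induction_on with
      | empty =>
        simp only [Finset.sum_empty]
        exact HasCompactSupport.zero
      | insert j s hj ih =>
        simp only [Finset.sum_insert hj]
        exact ((hfc j).smul_right (f' := fun _ => bW j)).add ih
    exact this _
  have hzero : ∀ x, ∑ I : Fin k → Fin n,
      LinearMap.adjoint (A I) (dirDeriv n k I φ x) = 0 := by
    intro x
    refine InnerProductSpace.ext_inner_left_basis bV.toBasis fun l => ?_
    have h1 : ∀ I, dirDeriv n k I φ x =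
        ∑ j, diffOp n (∏ i, MvPolynomial.X (I i)) (f j) x • bW j := fun I => by
      rw [dirDeriv_sum_smul _ _ _ _ _ (fun j => (f j).smooth ⊤)]
      simp only [diffOp_monomial]
    have h2 : ∑ j, diffOp n (symbolMatrix n k A j l) (f j) = 0 := by
      simp only [f, map_sum, map_smul, ← diffOp_mul]
      rw [Finset.sum_comm]
      refine Finset.sum_eq_zero fun l' _ => ?_
      rw [← Finset.smul_sum, ← LinearMap.sum_apply, ← map_sum]
      have := congrFun (congrFun (transpose_symbolMatrix_mul_annihilator n k A) l) l'
      rw [Matrix.mul_apply] at this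
      simp only [Matrix.transpose_apply] at this
      rw [this]
      simp
    have h3 := congrArg (fun g : 𝓢(Euc n, ℝ) => g x) h2
    simp only [symbolMatrix, map_sum, LinearMap.sum_apply, diffOp_mul, diffOp_C,
      sum_apply, smul_apply, zero_apply] at h3
    rw [inner_zero_right, inner_sum, ← h3, Finset.sum_comm]
    refine Finset.sum_congr rfl fun I _ => ?_
    rw [LinearMap.adjoint_inner_right, h1, inner_sum]
    refine Finset.sum_congr rfl fun j _ => ?_
    rw [inner_smul_right, real_inner_comm, smul_eq_mul, mul_comm]
    rfl
  have h4 := h φ hφ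
  rw [← integral_finsetSum _ fun I _ => ?_] at h4
  · simp only [← inner_sum, hzero, inner_zero_right, integral_zero, mul_zero] at h4
    have h5 : φ 0 = (gramDet n k A).eval (fun i => ξ i) • η := by
      have h6 : ∀ j, f j 0 = (gramDet n k A).eval (fun i => ξ i) * c j := by
        intro j
        have := congrFun (eval_annihilator_mulVec n k A ξ c hc) j
        rw [Pi.smul_apply, smul_eq_mul] at this
        rw [← this]
        simp only [f, sum_apply, smul_apply, Matrix.mulVec, dotProduct,
          Matrix.map_apply]
        refine Finset.sum_congr rfl fun l _ => ?_
        rw [(diffOp_eventuallyEq_exp n _ ξ 1 ψ hψ).eq_of_nhds]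
        simp [mul_comm]
      simp only [φ, h6, mul_smul, ← Finset.smul_sum]
      congr 1
      exact bW.sum_repr' η
    rw [h5, inner_smul_right] at h4
    exact (mul_eq_zero.1 h4.symm).resolve_left (eval_gramDet_ne_zero n k A hell ξ hξ)
  · have := hφ.dirDeriv k I
    exact LocallyIntegrable.integrable_inner hu
      ((LinearMap.continuous_of_finiteDimensional _).comp this.1.continuous)
      (this.2.comp_left (map_zero _))

end Necessity

section Taylor

variable {E : Type*} [NormedAddCommGroup E] [NormedSpace ℝ E]

theorem ContinuousMultilinearMap.contDiff_diagonal {j : ℕ} (M : E [×j]→L[ℝ] ℝ) :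
    ContDiff ℝ ∞ fun x => M fun _ => x :=
  M.contDiff.comp (contDiff_pi' fun _ => contDiff_id)

theorem ContinuousMultilinearMap.iteratedFDeriv_diagonal_smul {j : ℕ} (M : E [×j]→L[ℝ] ℝ)
    (l : ℕ) (r : ℝ) (x : E) :
    r ^ l • iteratedFDeriv ℝ l (fun x => M fun _ => x) (r • x) =
      r ^ j • iteratedFDeriv ℝ l (fun x => M fun _ => x) x := by
  have h1 : ContDiff ℝ l fun x => M fun _ => x := M.contDiff_diagonal.of_le (mod_cast le_top)
  rw [← congrFun (iteratedFDeriv_comp_const_smul r h1) x,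
    ← iteratedFDeriv_const_smul_apply h1.contDiffAt]
  congr 1
  funext y
  simpa using M.map_smul_univ (fun _ => r) fun _ => y

theorem ContinuousMultilinearMap.iteratedFDeriv_diagonal_zero {j l : ℕ} (hl : l ≠ j)
    (M : E [×j]→L[ℝ] ℝ) : iteratedFDeriv ℝ l (fun x => M fun _ => x) 0 = 0 := by
  have h := M.iteratedFDeriv_diagonal_smul l 2 0
  rw [smul_zero, ← sub_eq_zero, ← sub_smul] at h
  refine (smul_eq_zero.1 h).resolve_left (sub_ne_zero.2 fun h' => hl ?_)
  exact pow_right_injective₀ two_pos (by norm_num) h'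

theorem ContinuousMultilinearMap.iteratedFDeriv_diagonal_of_lt {j l : ℕ} (hl : j < l)
    (M : E [×j]→L[ℝ] ℝ) (x : E) : iteratedFDeriv ℝ l (fun x => M fun _ => x) x = 0 := by
  let g : ℝ → E [×l]→L[ℝ] ℝ := fun r =>
    r ^ (l - j) • iteratedFDeriv ℝ l (fun x => M fun _ => x) (r • x)
  have hg : Continuous g := by
    have := M.contDiff_diagonal.continuous_iteratedFDeriv (m := l) (mod_cast le_top)
    fun_prop
  have h1 : Tendsto g (𝓝[>] 0) (𝓝 (g 0)) := hg.continuousAt.tendsto.mono_left nhdsWithin_le_nhds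
  have h2 : Tendsto g (𝓝[>] 0) (𝓝 (iteratedFDeriv ℝ l (fun x => M fun _ => x) x)) := by
    refine tendsto_const_nhds.congr' ?_
    filter_upwards [self_mem_nhdsWithin] with r hr
    have hr' : (r : ℝ) ^ j ≠ 0 := (pow_pos hr j).ne'
    apply smul_right_injective _ hr'
    simp only [g]
    rw [smul_smul, ← pow_add, Nat.add_sub_cancel' hl.le, M.iteratedFDeriv_diagonal_smul]
  rw [tendsto_nhds_unique h2 h1]
  simp [g, Nat.sub_ne_zero_of_lt hl]

/-- The Taylor polynomial of `f` at the origin, of degree less than `N`. -/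
noncomputable def taylorPoly (N : ℕ) (f : E → ℝ) (x : E) : ℝ :=
  ∑ j ∈ Finset.range N, ((j.factorial : ℝ)⁻¹ • iteratedFDeriv ℝ j f 0) fun _ => x

theorem contDiff_taylorPoly (N : ℕ) (f : E → ℝ) : ContDiff ℝ ∞ (taylorPoly N f) :=
  ContDiff.sum fun _ _ => ContinuousMultilinearMap.contDiff_diagonal _

theorem iteratedFDeriv_taylorPoly (N : ℕ) (f : E → ℝ) (l : ℕ) (x : E) :
    iteratedFDeriv ℝ l (taylorPoly N f) x = ∑ j ∈ Finset.range N, iteratedFDeriv ℝ l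
      (fun x => ((j.factorial : ℝ)⁻¹ • iteratedFDeriv ℝ j f 0) fun _ => x) x :=
  iteratedFDeriv_fun_sum_apply (f := fun j x =>
    ((j.factorial : ℝ)⁻¹ • iteratedFDeriv ℝ j f 0) fun _ => x) fun _ _ =>
      ((ContinuousMultilinearMap.contDiff_diagonal _).of_le (mod_cast le_top)).contDiffAt

theorem iteratedFDeriv_taylorPoly_of_le {N l : ℕ} (h : N ≤ l) (f : E → ℝ) (x : E) :
    iteratedFDeriv ℝ l (taylorPoly N f) x = 0 := by
  rw [iteratedFDeriv_taylorPoly]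
  exact Finset.sum_eq_zero fun j hj => ContinuousMultilinearMap.iteratedFDeriv_diagonal_of_lt
    ((Finset.mem_range.1 hj).trans_le h) _ _

theorem iteratedFDeriv_taylorPoly_zero {N l : ℕ} (h : l < N) (f : E → ℝ)
    (hf : ∀ (v : Fin l → E) (σ : Equiv.Perm (Fin l)),
      iteratedFDeriv ℝ l f 0 (fun i => v (σ i)) = iteratedFDeriv ℝ l f 0 v) :
    iteratedFDeriv ℝ l (taylorPoly N f) 0 = iteratedFDeriv ℝ l f 0 := by
  rw [iteratedFDeriv_taylorPoly, Finset.sum_eq_single l]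
  · ext v
    rw [ContinuousMultilinearMap.iteratedFDeriv_comp_diagonal]
    simp only [smul_apply, hf, Finset.sum_const,
      Finset.card_univ, Fintype.card_perm, Fintype.card_fin, nsmul_eq_mul, smul_eq_mul]
    rw [← mul_assoc, mul_inv_cancel₀ (Nat.cast_ne_zero.2 l.factorial_ne_zero), one_mul]
  · exact fun j _ hj => ContinuousMultilinearMap.iteratedFDeriv_diagonal_zero hj.symm _
  · exact fun h' => absurd (Finset.mem_range.2 h) h'

theorem SchwartzMap.iteratedFDeriv_comp_perm (n : ℕ) (ψ : 𝓢(Euc n, ℝ)) (x : Euc n) {l : ℕ}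
    (v : Fin l → Euc n) (σ : Equiv.Perm (Fin l)) :
    iteratedFDeriv ℝ l ψ x (fun i => v (σ i)) = iteratedFDeriv ℝ l ψ x v := by
  let M := (iteratedFDeriv ℝ l ψ x).toMultilinearMap
  have h : M.domDomCongr σ = M := by
    refine Module.Basis.ext_multilinear (fun _ => (EuclideanSpace.basisFun (Fin n) ℝ).toBasis)
      fun I => ?_
    have h1 : ∀ J : Fin l → Fin n, M (fun i => (EuclideanSpace.basisFun (Fin n) ℝ).toBasis (J i)) =
        diffOp n (∏ i, MvPolynomial.X (J i)) ψ x := fun J => by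
      rw [diffOp_monomial]
      simp [M, dirDeriv, stdVec]
    rw [MultilinearMap.domDomCongr_apply, h1 I, h1 fun i => I (σ i),
      Equiv.prod_comp σ fun i => MvPolynomial.X (I i)]
  exact congrArg (fun L : MultilinearMap ℝ (fun _ : Fin l => Euc n) ℝ => L v) h

theorem exists_norm_iteratedFDeriv_le_pow [FiniteDimensional ℝ E] {R : E → ℝ}
    (hR : ContDiff ℝ ∞ R) {N : ℕ} (h0 : ∀ j < N, iteratedFDeriv ℝ j R 0 = 0) (ρ : ℝ) (l : ℕ) :
    ∃ C, 0 ≤ C ∧ ∀ y, ‖y‖ ≤ ρ → ‖iteratedFDeriv ℝ l R y‖ ≤ C * ‖y‖ ^ (N - l) := by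
  have : ProperSpace E := FiniteDimensional.proper ℝ E
  induction hd : N - l generalizing l with
  | zero =>
    have hc : Continuous (iteratedFDeriv ℝ l R) :=
      hR.continuous_iteratedFDeriv (mod_cast le_top)
    obtain ⟨C, hC⟩ := (isCompact_closedBall (0 : E) ρ).exists_bound_of_continuousOn hc.continuousOn
    refine ⟨max C 0, le_max_right _ _, fun y hy => ?_⟩
    simpa using (hC y (by simpa using hy)).trans (le_max_left C 0)
  | succ d ih =>
    obtain ⟨C, hC0, hC⟩ := ih (l + 1) (by omega)
    refine ⟨C, hC0, fun y hy => ?_⟩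
    have h1 := (convex_closedBall (0 : E) ‖y‖).norm_image_sub_le_of_norm_fderiv_le (𝕜 := ℝ)
      (f := iteratedFDeriv ℝ l R) (C := C * ‖y‖ ^ d) (x := 0) (y := y)
      (fun z _ => (hR.differentiable_iteratedFDeriv (m := l)
        (by exact_mod_cast ENat.natCast_lt_top l)) z) (fun z hz => ?_) (by simp) (by simp)
    · rw [h0 l (by omega), sub_zero, sub_zero] at h1
      rwa [pow_succ, ← mul_assoc]
    · rw [norm_fderiv_iteratedFDeriv]
      have hz' : ‖z‖ ≤ ‖y‖ := by simpa using hz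
      exact (hC z (hz'.trans hy)).trans (by gcongr)

end Taylor

section ParametricIntegral

variable {α E F : Type*} [MeasurableSpace α] {μ : Measure α}
  [NormedAddCommGroup E] [NormedSpace ℝ E] [NormedAddCommGroup F] [NormedSpace ℝ F]
  [CompleteSpace F]

theorem hasFTaylorSeriesUpToOn_integral {U : Set E} {f : α → E → F}
    (hf : ∀ a, ContDiff ℝ ∞ (f a))
    (hm : ∀ l x, AEStronglyMeasurable (fun a => iteratedFDeriv ℝ l (f a) x) μ)
    (hb : ∀ l, ∀ x ∈ U, ∃ t ∈ 𝓝 x, ∃ b : α → ℝ, Integrable b μ ∧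
      ∀ a, ∀ y ∈ t, ‖iteratedFDeriv ℝ l (f a) y‖ ≤ b a) :
    HasFTaylorSeriesUpToOn ∞ (fun x => ∫ a, f a x ∂μ)
      (fun x l => ∫ a, iteratedFDeriv ℝ l (f a) x ∂μ) U := by
  have hfi : ∀ l, ∀ x ∈ U, Integrable (fun a => iteratedFDeriv ℝ l (f a) x) μ := by
    intro l x hx
    obtain ⟨t, ht, b, hbi, hbb⟩ := hb l x hx
    exact hbi.mono' (hm l x) (ae_of_all _ fun a => hbb a x (mem_of_mem_nhds ht))
  have hderiv : ∀ l, ∀ x ∈ U, HasFDerivAt (fun x => ∫ a, iteratedFDeriv ℝ l (f a) x ∂μ)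
      (∫ a, iteratedFDeriv ℝ (l + 1) (f a) x ∂μ).curryLeft x := by
    intro l x hx
    obtain ⟨t, ht, b, hbi, hbb⟩ := hb (l + 1) x hx
    let e := (continuousMultilinearCurryLeftEquiv ℝ (fun _ : Fin (l + 1) => E) F)
    have h1 : (∫ a, iteratedFDeriv ℝ (l + 1) (f a) x ∂μ).curryLeft =
        ∫ a, e (iteratedFDeriv ℝ (l + 1) (f a) x) ∂μ := by
      let L : (E [×(l + 1)]→L[ℝ] F) →L[ℝ] (E →L[ℝ] E [×l]→L[ℝ] F) := e.toContinuousLinearEquiv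
      exact (ContinuousLinearMap.integral_comp_comm (𝕜 := ℝ) (Fₗ := E →L[ℝ] E [×l]→L[ℝ] F) L
        (hfi (l + 1) x hx)).symm
    rw [h1]
    refine hasFDerivAt_integral_of_dominated_of_fderiv_le (𝕜 := ℝ) (bound := b) ht
      (F' := fun y a => e (iteratedFDeriv ℝ (l + 1) (f a) y))
      (Eventually.of_forall (hm l)) (hfi l x hx)
      (e.continuous.comp_aestronglyMeasurable (hm (l + 1) x))
      (ae_of_all _ fun a y hy => ?_) hbi (ae_of_all _ fun a y _ => ?_)
    · rw [LinearIsometryEquiv.norm_map]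
      exact hbb a y hy
    · have h2 := ((hf a).differentiable_iteratedFDeriv (m := l)
        (by exact_mod_cast ENat.natCast_lt_top l) y).hasFDerivAt
      rwa [fderiv_iteratedFDeriv] at h2
  refine ⟨fun x hx => ?_, fun l _ x hx => (hderiv l x hx).hasFDerivWithinAt,
    fun l _ x hx => (hderiv l x hx).continuousAt.continuousWithinAt⟩
  exact ((continuousMultilinearCurryFin0 ℝ E F).toContinuousLinearEquiv.toContinuousLinearMap
    |>.integral_comp_comm (hfi 0 x hx)).symm

theorem contDiffOn_integral_of_dominated {U : Set E} {f : α → E → F}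
    (hf : ∀ a, ContDiff ℝ ∞ (f a))
    (hm : ∀ l x, AEStronglyMeasurable (fun a => iteratedFDeriv ℝ l (f a) x) μ)
    (hb : ∀ l, ∀ x ∈ U, ∃ t ∈ 𝓝 x, ∃ b : α → ℝ, Integrable b μ ∧
      ∀ a, ∀ y ∈ t, ‖iteratedFDeriv ℝ l (f a) y‖ ≤ b a) :
    ContDiffOn ℝ ∞ (fun x => ∫ a, f a x ∂μ) U :=
  (hasFTaylorSeriesUpToOn_integral hf hm hb).contDiffOn

theorem iteratedFDeriv_integral_of_dominated {U : Set E} (hU : IsOpen U) {f : α → E → F}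
    (hf : ∀ a, ContDiff ℝ ∞ (f a))
    (hm : ∀ l x, AEStronglyMeasurable (fun a => iteratedFDeriv ℝ l (f a) x) μ)
    (hb : ∀ l, ∀ x ∈ U, ∃ t ∈ 𝓝 x, ∃ b : α → ℝ, Integrable b μ ∧
      ∀ a, ∀ y ∈ t, ‖iteratedFDeriv ℝ l (f a) y‖ ≤ b a) (l : ℕ) {x : E} (hx : x ∈ U) :
    iteratedFDeriv ℝ l (fun x => ∫ a, f a x ∂μ) x = ∫ a, iteratedFDeriv ℝ l (f a) x ∂μ := by
  rw [(hasFTaylorSeriesUpToOn_integral hf hm hb).eq_iteratedFDerivWithin_of_uniqueDiffOn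
    (m := l) (mod_cast le_top) hU.uniqueDiffOn hx, iteratedFDerivWithin_of_isOpen l hU hx]

end ParametricIntegral

section HomogeneousKernel

variable {n k : ℕ}

theorem integrable_exp_neg_abs : Integrable fun s : ℝ => Real.exp (-|s|) := by
  rw [← integrableOn_univ, ← Set.Iic_union_Ioi (a := (0 : ℝ))]
  refine IntegrableOn.union ?_ ?_
  · refine (integrableOn_exp_Iic 0).congr_fun (fun s hs => ?_) measurableSet_Iic
    simp [abs_of_nonpos (Set.mem_Iic.1 hs)]
  · refine (integrableOn_exp_neg_Ioi 0).congr_fun (fun s hs => ?_) measurableSet_Ioi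
    simp [abs_of_pos (Set.mem_Ioi.1 hs)]

/-- The dilates of `ψ`, regularized near the origin by a Taylor polynomial, whose superposition is
a homogeneous kernel of degree `k - n`. -/
noncomputable def dilate (n k : ℕ) (ψ : 𝓢(Euc n, ℝ)) (s : ℝ) (x : Euc n) : ℝ :=
  Real.exp (((n : ℝ) - k) * s) *
    (ψ (Real.exp s • x) - if s < 0 then taylorPoly (k + 1 - n) ψ (Real.exp s • x) else 0)

/-- The superposition of all regularized dilates of `ψ`. -/
noncomputable def homKernel (n k : ℕ) (ψ : 𝓢(Euc n, ℝ)) (x : Euc n) : ℝ :=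
  ∫ s, dilate n k ψ s x

theorem contDiff_dilate (ψ : 𝓢(Euc n, ℝ)) (s : ℝ) : ContDiff ℝ ∞ (dilate n k ψ s) := by
  have h1 : ContDiff ℝ ∞ fun x : Euc n => Real.exp s • x := contDiff_const_smul _
  unfold dilate
  split_ifs
  · exact contDiff_const.mul (((ψ.smooth ⊤).comp h1).sub ((contDiff_taylorPoly _ _).comp h1))
  · exact contDiff_const.mul (((ψ.smooth ⊤).comp h1).sub contDiff_const)

theorem iteratedFDeriv_dilate (ψ : 𝓢(Euc n, ℝ)) (s : ℝ) (l : ℕ) (x : Euc n) :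
    iteratedFDeriv ℝ l (dilate n k ψ s) x = Real.exp (((n : ℝ) - k + l) * s) •
      (iteratedFDeriv ℝ l ψ (Real.exp s • x) -
        if s < 0 then iteratedFDeriv ℝ l (taylorPoly (k + 1 - n) ψ) (Real.exp s • x) else 0) := by
  have hψ : ContDiff ℝ l ψ := (ψ.smooth ⊤).of_le (mod_cast le_top)
  have hT : ContDiff ℝ l (taylorPoly (k + 1 - n) ψ) :=
    (contDiff_taylorPoly _ _).of_le (mod_cast le_top)
  let g : Euc n → ℝ := fun y => ψ y - if s < 0 then taylorPoly (k + 1 - n) ψ y else 0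
  have hg : ContDiff ℝ l g := by
    unfold g
    split_ifs
    · exact hψ.sub hT
    · exact hψ.sub contDiff_const
  have h1 : dilate n k ψ s = Real.exp (((n : ℝ) - k) * s) • fun y => g (Real.exp s • y) := rfl
  have h2 : iteratedFDeriv ℝ l g (Real.exp s • x) = iteratedFDeriv ℝ l ψ (Real.exp s • x) -
      if s < 0 then iteratedFDeriv ℝ l (taylorPoly (k + 1 - n) ψ) (Real.exp s • x) else 0 := by
    unfold g
    split_ifs
    · exact iteratedFDeriv_sub_apply hψ.contDiffAt hT.contDiffAt
    · simp
  rw [h1, iteratedFDeriv_const_smul_apply (f := fun y => g (Real.exp s • y))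
      (hg.comp (contDiff_const_smul _)).contDiffAt,
    iteratedFDeriv_comp_const_smul _ hg]
  change _ • Real.exp s ^ l • iteratedFDeriv ℝ l g (Real.exp s • x) = _
  rw [h2, smul_smul, ← Real.exp_nat_mul, ← Real.exp_add]
  congr 2
  ring

theorem iteratedFDeriv_sub_taylorPoly_zero (ψ : 𝓢(Euc n, ℝ)) (N : ℕ) :
    ∀ j < N, iteratedFDeriv ℝ j (fun y => ψ y - taylorPoly N ψ y) 0 = 0 := by
  intro j hj
  refine (iteratedFDeriv_sub_apply (ψ.smooth j).contDiffAt
    ((contDiff_taylorPoly _ _).of_le (mod_cast le_top)).contDiffAt).trans ?_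
  rw [iteratedFDeriv_taylorPoly_zero hj _ (SchwartzMap.iteratedFDeriv_comp_perm n ψ 0), sub_self]

theorem exists_norm_iteratedFDeriv_dilate_le_of_neg (ψ : 𝓢(Euc n, ℝ)) (l : ℕ) (ρ : ℝ) :
    ∃ C, 0 ≤ C ∧ ∀ s < 0, ∀ x, ‖x‖ ≤ ρ →
      ‖iteratedFDeriv ℝ l (dilate n k ψ s) x‖ ≤ C * Real.exp (-|s|) := by
  let N := k + 1 - n
  have hR : ContDiff ℝ ∞ fun y => ψ y - taylorPoly N ψ y :=
    (ψ.smooth ⊤).sub (contDiff_taylorPoly _ _)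
  obtain ⟨C, hC0, hC⟩ := exists_norm_iteratedFDeriv_le_pow hR
    (iteratedFDeriv_sub_taylorPoly_zero ψ N) ρ l
  refine ⟨C * |ρ| ^ (N - l), by positivity, fun s hs x hx => ?_⟩
  have h1 : iteratedFDeriv ℝ l (fun y => ψ y - taylorPoly N ψ y) (Real.exp s • x) =
      iteratedFDeriv ℝ l ψ (Real.exp s • x) -
        iteratedFDeriv ℝ l (taylorPoly (k + 1 - n) ψ) (Real.exp s • x) :=
    iteratedFDeriv_sub_apply (ψ.smooth l).contDiffAt
      ((contDiff_taylorPoly _ _).of_le (mod_cast le_top)).contDiffAt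
  have h2 : ‖Real.exp s • x‖ = Real.exp s * ‖x‖ := by
    rw [norm_smul, Real.norm_eq_abs, Real.abs_exp]
  have h3 : ‖Real.exp s • x‖ ≤ ρ := by
    rw [h2]
    exact (mul_le_of_le_one_left (norm_nonneg x) (Real.exp_le_one_iff.2 hs.le)).trans hx
  rw [iteratedFDeriv_dilate, if_pos hs, ← h1, norm_smul, Real.norm_eq_abs, Real.abs_exp,
    abs_of_neg hs, neg_neg]
  calc Real.exp (((n : ℝ) - k + l) * s) *
        ‖iteratedFDeriv ℝ l (fun y => ψ y - taylorPoly N ψ y) (Real.exp s • x)‖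
      ≤ Real.exp (((n : ℝ) - k + l) * s) * (C * (Real.exp s * |ρ|) ^ (N - l)) := by
        gcongr
        refine (hC _ h3).trans ?_
        rw [h2]
        gcongr
        exact hx.trans (le_abs_self ρ)
    _ = C * |ρ| ^ (N - l) * Real.exp (((n : ℝ) - k + l + (N - l : ℕ)) * s) := by
        rw [mul_pow, ← Real.exp_nat_mul, add_mul _ ((N - l : ℕ) : ℝ) s, Real.exp_add]
        ring
    _ ≤ C * |ρ| ^ (N - l) * Real.exp s := by
        gcongr
        have h4 : (1 : ℝ) ≤ (n : ℝ) - k + l + (N - l : ℕ) := by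
          have : (1 : ℤ) ≤ (n : ℤ) - k + l + (N - l : ℕ) := by omega
          exact_mod_cast this
        nlinarith

theorem exists_norm_iteratedFDeriv_dilate_le_of_nonneg (ψ : 𝓢(Euc n, ℝ)) (l : ℕ) {r : ℝ}
    (hr : 0 < r) : ∃ C, 0 ≤ C ∧ ∀ s, 0 ≤ s → ∀ x, r ≤ ‖x‖ →
      ‖iteratedFDeriv ℝ l (dilate n k ψ s) x‖ ≤ C * Real.exp (-|s|) := by
  obtain ⟨C, hC0, hC⟩ := ψ.decay (n + l + 1) l
  refine ⟨C / r ^ (n + l + 1), by positivity, fun s hs x hx => ?_⟩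
  rw [iteratedFDeriv_dilate, if_neg hs.not_gt, sub_zero, norm_smul, Real.norm_eq_abs,
    Real.abs_exp, abs_of_nonneg hs]
  have h1 : (Real.exp s * r) ^ (n + l + 1) * ‖iteratedFDeriv ℝ l ψ (Real.exp s • x)‖ ≤ C := by
    refine le_trans ?_ (hC (Real.exp s • x))
    rw [norm_smul, Real.norm_eq_abs, Real.abs_exp]
    gcongr
  rw [div_mul_eq_mul_div, le_div_iff₀ (by positivity)]
  calc Real.exp (((n : ℝ) - k + l) * s) * ‖iteratedFDeriv ℝ l ψ (Real.exp s • x)‖ *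
        r ^ (n + l + 1)
      ≤ Real.exp (((n + l + 1 : ℕ) : ℝ) * s - s) * ‖iteratedFDeriv ℝ l ψ (Real.exp s • x)‖ *
        r ^ (n + l + 1) := by
        gcongr
        push_cast
        nlinarith [mul_nonneg (Nat.cast_nonneg (α := ℝ) k) hs]
    _ = (Real.exp s * r) ^ (n + l + 1) * ‖iteratedFDeriv ℝ l ψ (Real.exp s • x)‖ *
        Real.exp (-s) := by
        rw [sub_eq_add_neg, Real.exp_add, Real.exp_nat_mul, mul_pow]
        ring
    _ ≤ C * Real.exp (-s) := by gcongr

theorem exists_norm_iteratedFDeriv_dilate_le (ψ : 𝓢(Euc n, ℝ)) (l : ℕ) {r : ℝ}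
    (hr : 0 < r) (ρ : ℝ) : ∃ C, ∀ s x, r ≤ ‖x‖ → ‖x‖ ≤ ρ →
      ‖iteratedFDeriv ℝ l (dilate n k ψ s) x‖ ≤ C * Real.exp (-|s|) := by
  obtain ⟨C₁, _, h₁⟩ := exists_norm_iteratedFDeriv_dilate_le_of_neg (k := k) ψ l ρ
  obtain ⟨C₂, _, h₂⟩ := exists_norm_iteratedFDeriv_dilate_le_of_nonneg (k := k) ψ l hr
  refine ⟨max C₁ C₂, fun s x hx hx' => ?_⟩
  rcases lt_or_ge s 0 with hs | hs
  · exact (h₁ s hs x hx').trans (by gcongr; exact le_max_left _ _)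
  · exact (h₂ s hs x hx).trans (by gcongr; exact le_max_right _ _)

theorem aestronglyMeasurable_iteratedFDeriv_dilate (ψ : 𝓢(Euc n, ℝ)) (l : ℕ) (x : Euc n) :
    AEStronglyMeasurable (fun s => iteratedFDeriv ℝ l (dilate n k ψ s) x) volume := by
  simp only [iteratedFDeriv_dilate]
  have h1 := (ψ.smooth ⊤).continuous_iteratedFDeriv (m := l) (mod_cast le_top)
  have h2 := (contDiff_taylorPoly (k + 1 - n) ψ).continuous_iteratedFDeriv (m := l)
    (mod_cast le_top)
  have h3 : Continuous fun s : ℝ => Real.exp s • x := by fun_prop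
  refine AEStronglyMeasurable.smul (f := fun s : ℝ => Real.exp (((n : ℝ) - k + l) * s))
    (by fun_prop : Continuous _).aestronglyMeasurable
    ((h1.comp h3).aestronglyMeasurable.sub ?_)
  exact (StronglyMeasurable.ite measurableSet_Iio (h2.comp h3).stronglyMeasurable
    stronglyMeasurable_const).aestronglyMeasurable

theorem exists_bound_iteratedFDeriv_dilate (ψ : 𝓢(Euc n, ℝ)) (l : ℕ) :
    ∀ x ∈ {x : Euc n | x ≠ 0}, ∃ t ∈ 𝓝 x, ∃ b : ℝ → ℝ, Integrable b ∧
      ∀ s, ∀ y ∈ t, ‖iteratedFDeriv ℝ l (dilate n k ψ s) y‖ ≤ b s := by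
  intro x hx
  obtain ⟨C, hC⟩ := exists_norm_iteratedFDeriv_dilate_le (k := k) ψ l
    (half_pos (norm_pos_iff.2 hx)) (2 * ‖x‖)
  refine ⟨{y | ‖x‖ / 2 < ‖y‖ ∧ ‖y‖ < 2 * ‖x‖}, ?_, fun s => C * Real.exp (-|s|),
    integrable_exp_neg_abs.const_mul C, fun s y hy => hC s y hy.1.le hy.2.le⟩
  refine IsOpen.mem_nhds ((isOpen_lt continuous_const continuous_norm).inter
    (isOpen_lt continuous_norm continuous_const)) ⟨half_lt_self (norm_pos_iff.2 hx), ?_⟩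
  have := norm_pos_iff.2 hx
  change ‖x‖ < 2 * ‖x‖
  linarith

theorem contDiffOn_homKernel (ψ : 𝓢(Euc n, ℝ)) :
    ContDiffOn ℝ ∞ (homKernel n k ψ) {x : Euc n | x ≠ 0} :=
  contDiffOn_integral_of_dominated (contDiff_dilate ψ)
    (aestronglyMeasurable_iteratedFDeriv_dilate ψ) (exists_bound_iteratedFDeriv_dilate ψ)

theorem iteratedFDeriv_homKernel (ψ : 𝓢(Euc n, ℝ)) {l : ℕ} (hl : k < l + n) {x : Euc n}
    (hx : x ≠ 0) : iteratedFDeriv ℝ l (homKernel n k ψ) x =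
      ∫ s, Real.exp (((n : ℝ) - k + l) * s) • iteratedFDeriv ℝ l ψ (Real.exp s • x) := by
  refine (iteratedFDeriv_integral_of_dominated isOpen_ne (contDiff_dilate ψ)
    (aestronglyMeasurable_iteratedFDeriv_dilate ψ) (exists_bound_iteratedFDeriv_dilate ψ) l
    hx).trans ?_
  simp [iteratedFDeriv_dilate, iteratedFDeriv_taylorPoly_of_le (show k + 1 - n ≤ l by omega)]

theorem iteratedFDeriv_homKernel_smul (ψ : 𝓢(Euc n, ℝ)) {l : ℕ} (hl : k < l + n) {t : ℝ}
    (ht : 0 < t) {x : Euc n} (hx : x ≠ 0) : iteratedFDeriv ℝ l (homKernel n k ψ) (t • x) =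
      (t ^ ((k : ℤ) - (n : ℤ) - (l : ℤ))) • iteratedFDeriv ℝ l (homKernel n k ψ) x := by
  rw [iteratedFDeriv_homKernel ψ hl (smul_ne_zero ht.ne' hx), iteratedFDeriv_homKernel ψ hl hx,
    ← integral_smul, ← integral_add_right_eq_self (μ := volume) _ (-Real.log t)]
  refine integral_congr_ae (ae_of_all _ fun s => ?_)
  simp only []
  have h1 : Real.exp (s + -Real.log t) • t • x = Real.exp s • x := by
    rw [smul_smul, Real.exp_add, Real.exp_neg, Real.exp_log ht, inv_mul_cancel_right₀ ht.ne']
  have h2 : t ^ ((k : ℤ) - (n : ℤ) - (l : ℤ)) =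
      Real.exp (((n : ℝ) - k + l) * -Real.log t) := by
    rw [← Real.rpow_intCast, Real.rpow_def_of_pos ht]
    push_cast
    congr 1
    ring
  rw [h1, h2, smul_smul, mul_add, Real.exp_add, mul_comm]

end HomogeneousKernel

section HomogeneousKernelDistribution

variable {n k : ℕ}

theorem contDiff_dirDeriv {f : Euc n → ℝ} (hf : ContDiff ℝ ∞ f) (m : ℕ) (I : Fin m → Fin n) :
    ContDiff ℝ ∞ (dirDeriv n m I f) :=
  (ContinuousMultilinearMap.apply ℝ (fun _ : Fin m => Euc n) ℝ
    (fun i => stdVec n (I i))).contDiff.comp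
      (hf.iteratedFDeriv_right (m := ∞) (i := m) (by exact_mod_cast le_top))

theorem dirDeriv_succ {f : Euc n → ℝ} (hf : ContDiff ℝ ∞ f) (m : ℕ) (I : Fin (m + 1) → Fin n)
    (x : Euc n) : dirDeriv n (m + 1) I f x =
      fderiv ℝ (dirDeriv n m (fun i => I i.succ) f) x (stdVec n (I 0)) := by
  let L := ContinuousMultilinearMap.apply ℝ (fun _ : Fin m => Euc n) ℝ
    (fun i => stdVec n (I i.succ))
  have h1 : DifferentiableAt ℝ (iteratedFDeriv ℝ m f) x :=
    hf.differentiable_iteratedFDeriv (m := m) (by exact_mod_cast ENat.natCast_lt_top m) x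
  have h2 : fderiv ℝ (dirDeriv n m (fun i => I i.succ) f) x =
      L.comp (fderiv ℝ (iteratedFDeriv ℝ m f) x) :=
    (L.hasFDerivAt.comp x h1.hasFDerivAt).fderiv
  rw [h2, dirDeriv, iteratedFDeriv_succ_apply_left]
  rfl

theorem SchwartzMap.dirDeriv_succ_right (ψ : 𝓢(Euc n, ℝ)) (m : ℕ) (I : Fin (m + 1) → Fin n)
    (x : Euc n) : dirDeriv n (m + 1) I ψ x =
      dirDeriv n m (fun i => I i.succ) (partialDeriv n (I 0) ψ) x := by
  rw [← diffOp_monomial, ← diffOp_monomial, Fin.prod_univ_succ, mul_comm, diffOp_mul, diffOp_X]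

theorem integral_mul_dirDeriv {f : Euc n → ℝ} (hf : ContDiff ℝ ∞ f) (m : ℕ)
    (I : Fin m → Fin n) (φ : 𝓢(Euc n, ℝ)) (hφ : HasCompactSupport φ) :
    ∫ x, f x * dirDeriv n m I φ x = (-1) ^ m * ∫ x, dirDeriv n m I f x * φ x := by
  induction m generalizing φ with
  | zero => simp [dirDeriv]
  | succ m ih =>
    have hg := contDiff_dirDeriv hf m fun i => I i.succ
    have hφ' : HasCompactSupport (partialDeriv n (I 0) φ) := by
      rw [← diffOp_X]
      exact hφ.mono' (subset_closure.trans (tsupport_diffOp_subset n _ φ))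
    simp only [SchwartzMap.dirDeriv_succ_right, dirDeriv_succ hf]
    rw [ih (fun i => I i.succ) _ hφ']
    have h1 : ∀ x, partialDeriv n (I 0) φ x = fderiv ℝ φ x (stdVec n (I 0)) := fun x => by
      rw [partialDeriv_apply, SchwartzMap.lineDerivOp_apply_eq_fderiv]
    have h2 := integral_mul_fderiv_eq_neg_fderiv_mul_of_integrable (μ := volume) (𝕜 := ℝ)
      (f := dirDeriv n m (fun i => I i.succ) f) (g := φ) (v := stdVec n (I 0)) ?_ ?_ ?_ ?_ ?_
    · simp only [h1]
      rw [h2, pow_succ]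
      ring
    · exact (((hg.continuous_fderiv (by simp)).clm_apply continuous_const).mul
        φ.continuous).integrable_of_hasCompactSupport hφ.mul_left
    · simp only [← h1]
      exact (hg.continuous.mul (partialDeriv n (I 0) φ).continuous).integrable_of_hasCompactSupport
        hφ'.mul_left
    · exact (hg.continuous.mul φ.continuous).integrable_of_hasCompactSupport hφ.mul_left
    · exact fun x _ => hg.differentiable (by simp) x
    · exact fun x _ => φ.differentiable x

theorem measurable_dilate (ψ : 𝓢(Euc n, ℝ)) :
    Measurable fun p : ℝ × Euc n => dilate n k ψ p.1 p.2 := by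
  have h1 : Continuous fun p : ℝ × Euc n => Real.exp p.1 • p.2 := by fun_prop
  have h2 : Continuous fun p : ℝ × Euc n => Real.exp (((n : ℝ) - k) * p.1) := by fun_prop
  refine h2.measurable.mul ((ψ.continuous.comp h1).measurable.sub ?_)
  exact Measurable.ite (measurableSet_lt measurable_fst measurable_const)
    ((contDiff_taylorPoly _ ψ).continuous.comp h1).measurable measurable_const

theorem integral_norm_dilate_of_nonneg (ψ : 𝓢(Euc n, ℝ)) {s : ℝ} (hs : 0 ≤ s) :
    ∫ x, ‖dilate n k ψ s x‖ = Real.exp (-k * s) * ∫ x, ‖ψ x‖ := by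
  have h1 : ∀ x, ‖dilate n k ψ s x‖ =
      Real.exp (((n : ℝ) - k) * s) * ‖ψ (Real.exp s • x)‖ := fun x => by
    simp [dilate, hs.not_gt]
  simp only [h1]
  rw [integral_const_mul, Measure.integral_comp_smul volume (fun x => ‖ψ x‖), smul_eq_mul,
    finrank_euclideanSpace_fin, ← Real.exp_nat_mul, ← Real.exp_neg, Real.abs_exp, ← mul_assoc,
    ← Real.exp_add]
  congr 2
  ring

theorem integrable_dilate_of_nonneg (ψ : 𝓢(Euc n, ℝ)) {s : ℝ} (hs : 0 ≤ s) :
    Integrable (dilate n k ψ s) := by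
  have h1 : dilate n k ψ s = fun x =>
      Real.exp (((n : ℝ) - k) * s) * ψ (Real.exp s • x) := by
    funext x
    simp [dilate, hs.not_gt]
  rw [h1]
  exact (ψ.integrable.comp_smul (Real.exp_ne_zero s)).const_mul _

theorem integrable_dilate (hk : 1 ≤ k) (ψ : 𝓢(Euc n, ℝ)) (R : ℝ) :
    Integrable (fun p : ℝ × Euc n => dilate n k ψ p.1 p.2)
      (volume.prod (volume.restrict (closedBall 0 R))) := by
  rw [integrable_prod_iff (measurable_dilate ψ).aestronglyMeasurable]
  have hs : ∀ s, IntegrableOn (dilate n k ψ s) (closedBall 0 R) := fun s =>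
    (contDiff_dilate ψ s).continuous.continuousOn.integrableOn_compact
      (isCompact_closedBall 0 R)
  refine ⟨ae_of_all _ hs, ?_⟩
  obtain ⟨C, hC0, hC⟩ := exists_norm_iteratedFDeriv_dilate_le_of_neg (k := k) ψ 0 R
  refine (integrable_exp_neg_abs.const_mul
    (max (C * volume.real (closedBall (0 : Euc n) R)) (∫ x, ‖ψ x‖))).mono'
      ((measurable_dilate ψ).norm.stronglyMeasurable.integral_prod_right
        (f := fun s x => ‖dilate n k ψ s x‖)).aestronglyMeasurable (ae_of_all _ fun s => ?_)
  rw [Real.norm_of_nonneg (integral_nonneg fun _ => norm_nonneg _)]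
  rcases lt_or_ge s 0 with h | h
  · calc ∫ x in closedBall 0 R, ‖dilate n k ψ s x‖
        ≤ ∫ _ in closedBall (0 : Euc n) R, C * Real.exp (-|s|) := by
          refine setIntegral_mono_on (hs s).norm
            (integrableOn_const measure_closedBall_lt_top.ne) measurableSet_closedBall
            fun x hx => ?_
          have := hC s h x (by simpa using hx)
          rwa [norm_iteratedFDeriv_zero] at this
      _ = C * volume.real (closedBall (0 : Euc n) R) * Real.exp (-|s|) := by
          rw [setIntegral_const, smul_eq_mul]
          ring
      _ ≤ _ := by
          gcongr
          exact le_max_left _ _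
  · calc ∫ x in closedBall 0 R, ‖dilate n k ψ s x‖
        ≤ ∫ x, ‖dilate n k ψ s x‖ :=
          setIntegral_le_integral (integrable_dilate_of_nonneg ψ h).norm
            (ae_of_all _ fun _ => norm_nonneg _)
      _ = (∫ x, ‖ψ x‖) * Real.exp (-k * s) := by
          rw [integral_norm_dilate_of_nonneg ψ h, mul_comm]
      _ ≤ _ := by
          have hk' : (1 : ℝ) ≤ k := by exact_mod_cast hk
          gcongr
          · exact le_max_right _ _
          · rw [abs_of_nonneg h]
            nlinarith

theorem locallyIntegrable_homKernel (hk : 1 ≤ k) (ψ : 𝓢(Euc n, ℝ)) :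
    LocallyIntegrable (homKernel n k ψ) := by
  rw [locallyIntegrable_iff]
  intro K hK
  obtain ⟨R, hR⟩ := hK.isBounded.subset_closedBall 0
  exact IntegrableOn.mono_set (integrable_dilate hk ψ R).integral_prod_right hR

theorem integrable_dilate_mul (hk : 1 ≤ k) (ψ : 𝓢(Euc n, ℝ)) {φ : Euc n → ℝ}
    (hφ : Continuous φ) (hc : HasCompactSupport φ) :
    Integrable (fun p : ℝ × Euc n => dilate n k ψ p.1 p.2 * φ p.2) (volume.prod volume) := by
  obtain ⟨R, hR⟩ := hc.isCompact.isBounded.subset_closedBall 0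
  obtain ⟨C, hC⟩ := hφ.bounded_above_of_compact_support hc
  have h1 : Function.support (fun p : ℝ × Euc n => dilate n k ψ p.1 p.2 * φ p.2) ⊆
      Set.univ ×ˢ closedBall 0 R := fun p hp =>
    ⟨trivial, hR (subset_tsupport _ (right_ne_zero_of_mul hp))⟩
  rw [← integrableOn_iff_integrable_of_support_subset h1, IntegrableOn, ← Measure.prod_restrict,
    Measure.restrict_univ]
  exact (integrable_dilate hk ψ R).mul_bdd
    (hφ.comp continuous_snd).aestronglyMeasurable (ae_of_all _ fun p => hC p.2)

theorem integral_homKernel_mul (hk : 1 ≤ k) (ψ : 𝓢(Euc n, ℝ)) {φ : Euc n → ℝ}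
    (hφ : Continuous φ) (hc : HasCompactSupport φ) :
    ∫ x, homKernel n k ψ x * φ x = ∫ s, ∫ x, dilate n k ψ s x * φ x := by
  rw [integral_integral_swap (f := fun s x => dilate n k ψ s x * φ x)
    (integrable_dilate_mul hk ψ hφ hc)]
  simp only [homKernel, integral_mul_const]

theorem dirDeriv_dilate (hn : 1 ≤ n) (ψ : 𝓢(Euc n, ℝ)) (I : Fin k → Fin n) (s : ℝ) (x : Euc n) :
    dirDeriv n k I (dilate n k ψ s) x = Real.exp (n * s) * dirDeriv n k I ψ (Real.exp s • x) := by
  simp [dirDeriv, iteratedFDeriv_dilate,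
    iteratedFDeriv_taylorPoly_of_le (show k + 1 - n ≤ k by omega)]

theorem integral_dilate_mul_dirDeriv (hn : 1 ≤ n) (ψ : 𝓢(Euc n, ℝ)) (I : Fin k → Fin n)
    (φ : 𝓢(Euc n, ℝ)) (hφ : HasCompactSupport φ) (s : ℝ) :
    ∫ x, dilate n k ψ s x * dirDeriv n k I φ x =
      (-1) ^ k * ∫ x, Real.exp (n * s) * dirDeriv n k I ψ (Real.exp s • x) * φ x := by
  rw [integral_mul_dirDeriv (contDiff_dilate ψ s) k I φ hφ]
  simp only [dirDeriv_dilate hn]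

theorem integrable_integral_dirDeriv_comp_smul_mul (hn : 1 ≤ n) (hk : 1 ≤ k) (ψ : 𝓢(Euc n, ℝ))
    (I : Fin k → Fin n) (φ : 𝓢(Euc n, ℝ)) (hφ : HasCompactSupport φ) :
    Integrable fun s : ℝ =>
      ∫ x, Real.exp (n * s) * dirDeriv n k I ψ (Real.exp s • x) * φ x := by
  have hφ' : IsTestFun n φ := ⟨φ.smooth ⊤, hφ⟩
  have h := ((integrable_dilate_mul hk ψ (hφ'.dirDeriv k I).1.continuous
    (hφ'.dirDeriv k I).2).integral_prod_left).const_mul ((-1 : ℝ) ^ k)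
  refine h.congr (ae_of_all _ fun s => ?_)
  simp only [integral_dilate_mul_dirDeriv hn ψ I φ hφ]
  rw [← mul_assoc, ← mul_pow]
  simp

theorem integral_homKernel_mul_dirDeriv (hn : 1 ≤ n) (hk : 1 ≤ k) (ψ : 𝓢(Euc n, ℝ))
    (I : Fin k → Fin n) (φ : 𝓢(Euc n, ℝ)) (hφ : HasCompactSupport φ) :
    (-1) ^ k * ∫ x, homKernel n k ψ x * dirDeriv n k I φ x =
      ∫ s, ∫ x, Real.exp (n * s) * dirDeriv n k I ψ (Real.exp s • x) * φ x := by
  have hφ' : IsTestFun n φ := ⟨φ.smooth ⊤, hφ⟩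
  rw [integral_homKernel_mul hk ψ (hφ'.dirDeriv k I).1.continuous (hφ'.dirDeriv k I).2]
  simp only [integral_dilate_mul_dirDeriv hn ψ I φ hφ]
  rw [integral_const_mul, ← mul_assoc, ← mul_pow]
  simp

end HomogeneousKernelDistribution

open scoped FourierTransform

section Cutoff

variable {n : ℕ}

/-- A bump of unit mass on the real line, supported in `[1, 5]`. -/
noncomputable def unitBump : ℝ → ℝ :=
  (⟨1, 2, one_pos, one_lt_two⟩ : ContDiffBump (3 : ℝ)).normed volume

theorem unitBump_nonneg (s : ℝ) : 0 ≤ unitBump s := ContDiffBump.nonneg_normed _ s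

theorem contDiff_unitBump : ContDiff ℝ ∞ unitBump := ContDiffBump.contDiff_normed _

theorem integrable_unitBump : Integrable unitBump := ContDiffBump.integrable_normed _

theorem integral_unitBump : ∫ s, unitBump s = 1 := ContDiffBump.integral_normed _

theorem unitBump_eq_zero {s : ℝ} (hs : 2 ≤ |s - 3|) : unitBump s = 0 := by
  rw [← Function.notMem_support, unitBump, ContDiffBump.support_normed_eq, mem_ball,
    Real.dist_eq, not_lt]
  exact hs

/-- A radial cutoff supported in an annulus, whose dilates average to `1`. -/
noncomputable def annularCutoff (ξ : Euc n) : ℝ := unitBump (Real.log ‖ξ‖)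

theorem annularCutoff_nonneg (ξ : Euc n) : 0 ≤ annularCutoff ξ := unitBump_nonneg _

theorem annularCutoff_eq_zero_of_norm_le_one {ξ : Euc n} (hξ : ‖ξ‖ ≤ 1) :
    annularCutoff ξ = 0 := by
  refine unitBump_eq_zero ?_
  have h := Real.log_nonpos (norm_nonneg ξ) hξ
  rw [abs_of_neg (by linarith)]
  linarith

theorem hasCompactSupport_annularCutoff : HasCompactSupport (annularCutoff (n := n)) := by
  refine HasCompactSupport.intro (isCompact_closedBall (0 : Euc n) (Real.exp 5)) fun ξ hξ => ?_
  rw [mem_closedBall, dist_zero_right, not_le] at hξ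
  refine unitBump_eq_zero ?_
  have h := (Real.lt_log_iff_exp_lt ((Real.exp_pos _).trans hξ)).2 hξ
  rw [abs_of_pos (by linarith)]
  linarith

theorem contDiff_annularCutoff_mul {q : Euc n → ℝ} (hq : ∀ ξ ≠ 0, ContDiffAt ℝ ∞ q ξ) :
    ContDiff ℝ ∞ fun ξ => annularCutoff ξ * q ξ := by
  refine contDiff_iff_contDiffAt.2 fun ξ => ?_
  by_cases hξ : ξ = 0
  · have h : (fun ξ => annularCutoff ξ * q ξ) =ᶠ[𝓝 ξ] fun _ => 0 := by
      filter_upwards [closedBall_mem_nhds ξ one_pos] with y hy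
      rw [annularCutoff_eq_zero_of_norm_le_one (by simpa [hξ] using hy), zero_mul]
    exact contDiffAt_const.congr_of_eventuallyEq h
  · exact (contDiff_unitBump.contDiffAt.comp ξ
      ((contDiffAt_norm ℝ hξ).log (norm_ne_zero_iff.2 hξ))).mul (hq ξ hξ)

theorem contDiff_annularCutoff : ContDiff ℝ ∞ (annularCutoff (n := n)) := by
  simpa using contDiff_annularCutoff_mul (n := n) (q := fun _ => 1) fun _ _ => contDiffAt_const

theorem annularCutoff_exp_smul (s : ℝ) {ξ : Euc n} (hξ : ξ ≠ 0) :
    annularCutoff (Real.exp (-s) • ξ) = unitBump (Real.log ‖ξ‖ - s) := by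
  rw [annularCutoff, norm_smul, Real.norm_eq_abs, Real.abs_exp,
    Real.log_mul (Real.exp_ne_zero _) (norm_ne_zero_iff.2 hξ), Real.log_exp, neg_add_eq_sub]

theorem integrable_annularCutoff_exp_smul {ξ : Euc n} (hξ : ξ ≠ 0) :
    Integrable fun s : ℝ => annularCutoff (Real.exp (-s) • ξ) := by
  simp only [annularCutoff_exp_smul _ hξ]
  exact integrable_unitBump.comp_sub_left _

theorem integral_annularCutoff_exp_smul {ξ : Euc n} (hξ : ξ ≠ 0) :
    ∫ s : ℝ, annularCutoff (Real.exp (-s) • ξ) = 1 := by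
  simp only [annularCutoff_exp_smul _ hξ]
  rw [integral_sub_left_eq_self unitBump volume, integral_unitBump]

end Cutoff

section Reproducing

variable {n : ℕ}

theorem exp_mul_fourier_exp_smul (f : Euc n → ℂ) (s : ℝ) (x : Euc n) :
    (Real.exp (n * s) : ℂ) * 𝓕 f (Real.exp s • x) =
      𝓕 (fun ξ => f (Real.exp (-s) • ξ)) x := by
  have h := Measure.integral_comp_smul volume
    (fun v : Euc n => Real.fourierChar (-⟪v, Real.exp s • x⟫) • f v) (Real.exp (-s))
  have h1 : |(Real.exp (-s) ^ Module.finrank ℝ (Euc n))⁻¹| = Real.exp (n * s) := by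
    rw [finrank_euclideanSpace_fin, ← Real.exp_nat_mul, ← Real.exp_neg, Real.abs_exp]
    ring_nf
  have h2 : ∀ v : Euc n, ⟪Real.exp (-s) • v, Real.exp s • x⟫ = ⟪v, x⟫ := fun v => by
    rw [real_inner_smul_left, real_inner_smul_right, ← mul_assoc, ← Real.exp_add]
    simp
  rw [h1] at h
  simp only [h2] at h
  rw [Real.fourier_eq, Real.fourier_eq, h, Complex.real_smul]

theorem integral_exp_mul_fourier_exp_smul_mul {f g : Euc n → ℂ} (hf : Integrable f)
    (hg : Integrable g) (s : ℝ) :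
    ∫ x, (Real.exp (n * s) : ℂ) * 𝓕 f (Real.exp s • x) * g x =
      ∫ ξ, f (Real.exp (-s) • ξ) * 𝓕 g ξ := by
  simp only [exp_mul_fourier_exp_smul]
  have hf' : Integrable fun ξ => f (Real.exp (-s) • ξ) :=
    hf.comp_smul (Real.exp_ne_zero _)
  simpa using! VectorFourier.integral_fourierIntegral_smul_eq_flip (L := innerₗ (Euc n))
    Real.continuous_fourierChar continuous_inner hf' hg

theorem integral_integral_annularCutoff_mul (hn : 1 ≤ n) {g : Euc n → ℂ} (hg : Integrable g) :
    ∫ s : ℝ, ∫ ξ, (annularCutoff (Real.exp (-s) • ξ) : ℂ) * g ξ = ∫ ξ, g ξ := by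
  have : Nonempty (Fin n) := ⟨⟨0, hn⟩⟩
  have h0 : ∀ᵐ ξ : Euc n, ξ ≠ 0 := by
    simp [ae_iff, measure_singleton]
  have hm : AEStronglyMeasurable
      (fun p : ℝ × Euc n => (annularCutoff (Real.exp (-p.1) • p.2) : ℂ) * g p.2)
      (volume.prod volume) := by
    refine AEStronglyMeasurable.mul ?_ hg.aestronglyMeasurable.comp_snd
    refine Continuous.aestronglyMeasurable ?_
    exact Complex.continuous_ofReal.comp (contDiff_annularCutoff.continuous.comp (by fun_prop))
  have hi : Integrable
      (fun p : ℝ × Euc n => (annularCutoff (Real.exp (-p.1) • p.2) : ℂ) * g p.2)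
      (volume.prod volume) := by
    refine (integrable_prod_iff' hm).2 ⟨?_, ?_⟩
    · filter_upwards [h0] with ξ hξ
      exact (integrable_annularCutoff_exp_smul hξ).ofReal.mul_const _
    · refine hg.norm.congr ?_
      filter_upwards [h0] with ξ hξ
      simp only [norm_mul, Complex.norm_real, Real.norm_eq_abs, abs_of_nonneg
        (annularCutoff_nonneg _)]
      rw [integral_mul_const, integral_annularCutoff_exp_smul hξ, one_mul]
  rw [integral_integral_swap hi]
  refine integral_congr_ae ?_
  filter_upwards [h0] with ξ hξ
  rw [integral_mul_const, integral_complex_ofReal, integral_annularCutoff_exp_smul hξ]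
  simp

theorem integrable_ofReal_annularCutoff :
    Integrable fun ξ : Euc n => (annularCutoff ξ : ℂ) :=
  (contDiff_annularCutoff.continuous.integrable_of_hasCompactSupport
    hasCompactSupport_annularCutoff).ofReal

theorem integral_fourier_schwartz (ψ : 𝓢(Euc n, ℂ)) : ∫ ξ, 𝓕 ψ ξ = ψ 0 := by
  have h : (𝓕⁻ (𝓕 ψ)) 0 = ψ 0 := by rw [FourierTransform.fourierInv_fourier_eq]
  rw [← h, SchwartzMap.fourierInv_coe, Real.fourierInv_eq]
  simp

theorem integral_integral_exp_mul_fourier_annularCutoff (hn : 1 ≤ n) (ψ : 𝓢(Euc n, ℂ)) :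
    ∫ s : ℝ, ∫ x, (Real.exp (n * s) : ℂ) *
      𝓕 (fun ξ : Euc n => (annularCutoff ξ : ℂ)) (Real.exp s • x) * ψ x = ψ 0 := by
  simp only [integral_exp_mul_fourier_exp_smul_mul integrable_ofReal_annularCutoff ψ.integrable]
  rw [← integral_fourier_schwartz ψ, SchwartzMap.fourier_coe]
  refine integral_integral_annularCutoff_mul hn ?_
  rw [← SchwartzMap.fourier_coe]
  exact (𝓕 ψ).integrable

/-- The Fourier transform of the annular cutoff, which is real by symmetry. -/
noncomputable def annularKernel (x : Euc n) : ℝ :=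
  (𝓕 (fun ξ : Euc n => (annularCutoff ξ : ℂ)) x).re

theorem ofReal_annularKernel (x : Euc n) :
    (annularKernel x : ℂ) = 𝓕 (fun ξ : Euc n => (annularCutoff ξ : ℂ)) x := by
  refine Complex.conj_eq_iff_re.1 ?_
  rw [Real.fourier_eq, ← integral_conj, ← integral_neg_eq_self]
  refine integral_congr_ae (ae_of_all _ fun v => ?_)
  simp [annularCutoff, Circle.smul_def, ← Circle.coe_inv_eq_conj, AddChar.map_neg_eq_inv]

theorem integral_integral_exp_mul_annularKernel (hn : 1 ≤ n) (ψ : 𝓢(Euc n, ℝ)) :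
    ∫ s : ℝ, ∫ x, Real.exp (n * s) * annularKernel (Real.exp s • x) * ψ x = ψ 0 := by
  have h := integral_integral_exp_mul_fourier_annularCutoff hn
    (SchwartzMap.postcompCLM Complex.ofRealCLM ψ)
  simp only [← ofReal_annularKernel, SchwartzMap.postcompCLM_apply, Complex.ofRealCLM_apply,
    ← Complex.ofReal_mul, integral_complex_ofReal] at h
  exact_mod_cast h

end Reproducing

section RealFourier

variable {n : ℕ}

/-- The real part of the Fourier transform, divided by the constant produced by `k` derivatives. -/
noncomputable def reFourier (k : ℕ) (f : 𝓢(Euc n, ℝ)) : 𝓢(Euc n, ℝ) :=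
  SchwartzMap.postcompCLM Complex.reCLM
    (((-(2 * Real.pi * Complex.I)) ^ k)⁻¹ • 𝓕 (SchwartzMap.postcompCLM Complex.ofRealCLM f))

theorem SchwartzMap.integrable_prod_mul (k : ℕ) (I : Fin k → Fin n) (f : 𝓢(Euc n, ℝ)) :
    Integrable fun v : Euc n => (∏ i, v (I i)) * f v := by
  refine (f.integrable_pow_mul volume k).mono ?_ (ae_of_all _ fun v => ?_)
  · refine Continuous.aestronglyMeasurable (.mul ?_ f.continuous)
    fun_prop
  · rw [norm_mul, norm_mul, norm_norm, norm_pow, norm_norm, norm_prod]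
    gcongr
    refine (Finset.prod_le_prod (fun i _ => norm_nonneg _)
      fun i _ => PiLp.norm_apply_le v (I i)).trans ?_
    simp

theorem dirDeriv_fourier (k : ℕ) (I : Fin k → Fin n) (g : 𝓢(Euc n, ℂ)) (x : Euc n) :
    dirDeriv n k I (𝓕 g : 𝓢(Euc n, ℂ)) x = (-(2 * Real.pi * Complex.I)) ^ k *
      ∫ v : Euc n, Real.fourierChar (-⟪v, x⟫) • ((∏ i, v (I i) : ℝ) * g v) := by
  have h1 : ∀ m : ℕ, (m : ℕ∞) ≤ ⊤ → Integrable fun v => ‖v‖ ^ m * ‖g v‖ :=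
    fun m _ => g.integrable_pow_mul volume m
  have h2 := g.continuous.aestronglyMeasurable (μ := (volume : Measure (Euc n)))
  rw [dirDeriv, SchwartzMap.fourier_coe, Real.iteratedFDeriv_fourier h1 h2 (n := k) le_top,
    Real.fourier_continuousMultilinearMap_apply
      (VectorFourier.integrable_fourierPowSMulRight _ (h1 k le_top) h2), Real.fourier_eq, ← integral_const_mul]
  refine integral_congr_ae (ae_of_all _ fun v => ?_)
  have h3 : ∀ i, innerSL ℝ v (stdVec n (I i)) = v (I i) := fun i => by
    rw [innerSL_apply_apply, stdVec, EuclideanSpace.inner_single_right]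
    simp
  change Real.fourierChar (-⟪v, x⟫) • ((-(2 * Real.pi * Complex.I)) ^ k •
    (∏ i, innerSL ℝ v (stdVec n (I i))) • g v) = _
  simp only [h3, Circle.smul_def, smul_eq_mul, Complex.real_smul]
  ring

theorem dirDeriv_reFourier (k : ℕ) (I : Fin k → Fin n) (f : 𝓢(Euc n, ℝ)) (x : Euc n) :
    dirDeriv n k I (reFourier k f) x =
      (∫ v : Euc n, Real.fourierChar (-⟪v, x⟫) • (((∏ i, v (I i)) * f v : ℝ) : ℂ)).re := by
  set c : ℂ := (-(2 * Real.pi * Complex.I)) ^ k with hc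
  have hc0 : c ≠ 0 := by simp [hc, Real.pi_ne_zero]
  set g := SchwartzMap.postcompCLM Complex.ofRealCLM f
  have h1 : ContDiffAt ℝ k (c⁻¹ • 𝓕 g : 𝓢(Euc n, ℂ)) x := (SchwartzMap.smooth _ k).contDiffAt
  have h2 := Complex.reCLM.iteratedFDeriv_comp_left h1 (i := k) le_rfl
  have h3 := iteratedFDeriv_const_smul_apply (a := c⁻¹) ((𝓕 g).smooth k).contDiffAt (x := x)
  have h4 := dirDeriv_fourier k I g x
  simp only [Complex.ofReal_mul]
  rw [← hc] at h4
  unfold dirDeriv at h4 ⊢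
  refine (congrArg (fun T => T fun i => stdVec n (I i)) h2).trans ?_
  refine (congrArg (fun T => (T fun i => stdVec n (I i)).re) h3).trans ?_
  change (c⁻¹ * iteratedFDeriv ℝ k (𝓕 g : 𝓢(Euc n, ℂ)) x fun i => stdVec n (I i)).re = _
  rw [h4, inv_mul_cancel_left₀ hc0]
  rfl

theorem sum_mul_dirDeriv_reFourier {ι : Type*} [Fintype ι] (k : ℕ)
    (a : (Fin k → Fin n) → ι → ℝ) (f : ι → 𝓢(Euc n, ℝ)) (c : ℝ)
    (h : ∀ v : Euc n, ∑ I, ∑ l, a I l * ((∏ i, v (I i)) * f l v) = c * annularCutoff v)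
    (x : Euc n) :
    ∑ I, ∑ l, a I l * dirDeriv n k I (reFourier k (f l)) x = c * annularKernel x := by
  have hi : ∀ (I : Fin k → Fin n) l, Integrable fun v : Euc n =>
      Real.fourierChar (-⟪v, x⟫) • (a I l * (((∏ i, v (I i)) * f l v : ℝ) : ℂ)) := fun I l =>
    (Real.fourierIntegral_convergent_iff x).2
      (((SchwartzMap.integrable_prod_mul k I (f l)).ofReal).const_mul _)
  have h1 : ∀ (I : Fin k → Fin n) l, a I l * dirDeriv n k I (reFourier k (f l)) x =
      (∫ v : Euc n, Real.fourierChar (-⟪v, x⟫) •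
        (a I l * (((∏ i, v (I i)) * f l v : ℝ) : ℂ))).re := fun I l => by
    rw [dirDeriv_reFourier, ← Complex.re_ofReal_mul, ← integral_const_mul]
    simp only [mul_smul_comm]
  simp only [h1]
  simp only [← Complex.re_sum]
  have h2 : ∀ I, ∑ l, ∫ v : Euc n, Real.fourierChar (-⟪v, x⟫) •
      (a I l * (((∏ i, v (I i)) * f l v : ℝ) : ℂ)) = ∫ v : Euc n, ∑ l,
        Real.fourierChar (-⟪v, x⟫) • (a I l * (((∏ i, v (I i)) * f l v : ℝ) : ℂ)) :=
    fun I => (integral_finsetSum _ fun l _ => hi I l).symm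
  simp only [h2]
  rw [← integral_finsetSum _ fun I _ => integrable_finsetSum _ fun l _ => hi I l, annularKernel,
    ← Complex.re_ofReal_mul, Real.fourier_eq, ← integral_const_mul]
  congr 2 with v
  simp only [← Finset.smul_sum, mul_smul_comm, ← Complex.ofReal_mul, ← Complex.ofReal_sum, h]

end RealFourier

section Multiplier

variable {V W : Type*}
  [NormedAddCommGroup V] [InnerProductSpace ℝ V] [FiniteDimensional ℝ V]
  [NormedAddCommGroup W] [InnerProductSpace ℝ W] [FiniteDimensional ℝ W]

theorem contDiff_eval_mvPolynomial {n : ℕ} (p : MvPolynomial (Fin n) ℝ) :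
    ContDiff ℝ ∞ fun ξ : Euc n => p.eval fun i => ξ i := by
  induction p using MvPolynomial.induction_on with
  | C a => simpa using contDiff_const
  | add p q hp hq => simpa using hp.add hq
  | mul_X p i hp =>
    simpa using hp.mul (contDiff_piLp_apply (p := 2) (i := i))

/-- The coordinates of `𝒜†[ξ] w`, as a quotient of polynomials in `ξ`. -/
noncomputable def pinvCoord (n k : ℕ) (A : CoeffOp n k V W) (w : W)
    (l : Fin (Module.finrank ℝ V)) (ξ : Euc n) : ℝ :=
  ((((symbolMatrix n k A).transpose * symbolMatrix n k A).adjugate *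
      (symbolMatrix n k A).transpose).mulVec
        (fun j => MvPolynomial.C ⟪stdOrthonormalBasis ℝ W j, w⟫) l).eval (fun i => ξ i) /
    (gramDet n k A).eval fun i => ξ i

theorem contDiffAt_pinvCoord {n k : ℕ} {A : CoeffOp n k V W} (hell : IsElliptic n k A) (w : W)
    (l : Fin (Module.finrank ℝ V)) (ξ : Euc n) (hξ : ξ ≠ 0) :
    ContDiffAt ℝ ∞ (pinvCoord n k A w l) ξ :=
  (contDiff_eval_mvPolynomial _).contDiffAt.div (contDiff_eval_mvPolynomial _).contDiffAt
    (eval_gramDet_ne_zero n k A hell ξ hξ)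

theorem pinvCoord_symbolMap {n k : ℕ} {A : CoeffOp n k V W} (hell : IsElliptic n k A)
    (c : Fin (Module.finrank ℝ V) → ℝ) (l : Fin (Module.finrank ℝ V)) {ξ : Euc n} (hξ : ξ ≠ 0) :
    pinvCoord n k A (symbolMap n k A ξ (∑ i, c i • stdOrthonormalBasis ℝ V i)) l ξ = c l := by
  rw [pinvCoord, div_eq_iff (eval_gramDet_ne_zero n k A hell ξ hξ)]
  set M := symbolMatrixEval n k A ξ with hM
  have h1 : (((symbolMatrix n k A).transpose * symbolMatrix n k A).adjugate *
      (symbolMatrix n k A).transpose).map (MvPolynomial.eval fun i => ξ i) =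
        (M.transpose * M).adjugate * M.transpose := by
    rw [Matrix.map_mul, ← RingHom.mapMatrix_apply, RingHom.map_adjugate, RingHom.mapMatrix_apply,
      Matrix.map_mul, hM, symbolMatrixEval, Matrix.transpose_map]
  have h2 : ((M.transpose * M).adjugate * M.transpose).mulVec (M.mulVec c) =
      (M.transpose * M).det • c := by
    rw [Matrix.mulVec_mulVec, Matrix.mul_assoc, Matrix.adjugate_mul, Matrix.smul_mulVec,
      Matrix.one_mulVec]
  have h3 := congrFun h2 l
  rw [Pi.smul_apply, smul_eq_mul, mul_comm, ← eval_gramDet, ← h1] at h3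
  rw [← h3, RingHom.map_mulVec]
  have h4 : (MvPolynomial.eval fun i => ξ i) ∘ (fun j => MvPolynomial.C
      ⟪stdOrthonormalBasis ℝ W j, symbolMap n k A ξ (∑ i, c i • stdOrthonormalBasis ℝ V i)⟫) =
        M.mulVec c := by
    funext j
    rw [hM, symbolMatrixEval_mulVec]
    simp
  rw [h4]

theorem sum_mul_pinvCoord {n k : ℕ} {A : CoeffOp n k V W} (hell : IsElliptic n k A) {w : W}
    {ξ : Euc n} (hξ : ξ ≠ 0) (hw : w ∈ LinearMap.range (symbolMap n k A ξ))
    (j : Fin (Module.finrank ℝ W)) :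
    ∑ I : Fin k → Fin n, ∑ l, ⟪stdOrthonormalBasis ℝ W j, A I (stdOrthonormalBasis ℝ V l)⟫ *
      ((∏ i, ξ (I i)) * pinvCoord n k A w l ξ) = ⟪stdOrthonormalBasis ℝ W j, w⟫ := by
  obtain ⟨v, rfl⟩ := hw
  obtain ⟨c, rfl⟩ : ∃ c : Fin (Module.finrank ℝ V) → ℝ,
      v = ∑ i, c i • stdOrthonormalBasis ℝ V i :=
    ⟨_, ((stdOrthonormalBasis ℝ V).sum_repr v).symm⟩
  simp only [pinvCoord_symbolMap hell c _ hξ]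
  simp only [symbolMap, LinearMap.sum_apply, map_sum, map_smul, inner_sum, inner_smul_right,
    LinearMap.smul_apply, Finset.mul_sum]
  rw [Finset.sum_comm]
  refine Finset.sum_congr rfl fun l _ => Finset.sum_congr rfl fun I _ => by ring

end Multiplier

section FundamentalSolution

variable {n k : ℕ} {V W : Type*}
  [NormedAddCommGroup V] [InnerProductSpace ℝ V] [FiniteDimensional ℝ V]
  [NormedAddCommGroup W] [InnerProductSpace ℝ W] [FiniteDimensional ℝ W]

theorem exists_schwartz_sum_dirDeriv_eq_annularKernel {A : CoeffOp n k V W}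
    (hell : IsElliptic n k A) {w : W}
    (hw : ∀ ξ ≠ 0, w ∈ LinearMap.range (symbolMap n k A ξ)) :
    ∃ K : Fin (Module.finrank ℝ V) → 𝓢(Euc n, ℝ), ∀ j x,
      ∑ I, ∑ l, ⟪stdOrthonormalBasis ℝ W j, A I (stdOrthonormalBasis ℝ V l)⟫ *
        dirDeriv n k I (K l) x = ⟪stdOrthonormalBasis ℝ W j, w⟫ * annularKernel x := by
  have hc : ∀ l, HasCompactSupport fun ξ => annularCutoff ξ * pinvCoord n k A w l ξ :=
    fun l => hasCompactSupport_annularCutoff.mul_right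
  have hd := fun l => contDiff_annularCutoff_mul (contDiffAt_pinvCoord hell w l)
  refine ⟨fun l => reFourier k ((hc l).toSchwartzMap (hd l)), fun j x => ?_⟩
  refine sum_mul_dirDeriv_reFourier k _ _ _ (fun v => ?_) x
  by_cases hv : v = 0
  · have h0 : annularCutoff v = 0 := annularCutoff_eq_zero_of_norm_le_one (by simp [hv])
    simp [h0]
  · rw [← sum_mul_pinvCoord hell hv (hw v hv) j, Finset.sum_mul]
    simp only [Finset.sum_mul]
    refine Finset.sum_congr rfl fun I _ => Finset.sum_congr rfl fun l _ => ?_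
    change _ * (_ * (annularCutoff v * pinvCoord n k A w l v)) = _
    ring

/-- The field whose coordinates are the homogeneous kernels of the profiles `K`. -/
noncomputable def homField (n k : ℕ) (K : Fin (Module.finrank ℝ V) → 𝓢(Euc n, ℝ)) (x : Euc n) :
    V :=
  ∑ l, homKernel n k (K l) x • stdOrthonormalBasis ℝ V l

theorem locallyIntegrable_homField (hk : 1 ≤ k) (K : Fin (Module.finrank ℝ V) → 𝓢(Euc n, ℝ)) :
    LocallyIntegrable (homField n k K) :=
  locallyIntegrable_finsetSum _ fun l _ x => by
    obtain ⟨s, hs, h⟩ := locallyIntegrable_homKernel hk (K l) x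
    exact ⟨s, hs, Integrable.smul_const h _⟩

theorem contDiffOn_homField (K : Fin (Module.finrank ℝ V) → 𝓢(Euc n, ℝ)) :
    ContDiffOn ℝ ∞ (homField n k K) {x : Euc n | x ≠ 0} :=
  ContDiffOn.sum fun l _ => (contDiffOn_homKernel (K l)).smul contDiffOn_const

theorem iteratedFDeriv_homField (K : Fin (Module.finrank ℝ V) → 𝓢(Euc n, ℝ)) (l : ℕ)
    {x : Euc n} (hx : x ≠ 0) : iteratedFDeriv ℝ l (homField n k K) x =
      ∑ i, (iteratedFDeriv ℝ l (homKernel n k (K i)) x).smulRight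
        (stdOrthonormalBasis ℝ V i) := by
  have h1 : ∀ i, ContDiffAt ℝ l (homKernel n k (K i)) x := fun i =>
    ((contDiffOn_homKernel (K i)).contDiffAt (isOpen_ne.mem_nhds hx)).of_le (mod_cast le_top)
  unfold homField
  rw [iteratedFDeriv_fun_sum_apply
    (f := fun i y => homKernel n k (K i) y • stdOrthonormalBasis ℝ V i) fun i _ => (h1 i).smul contDiffAt_const]
  refine Finset.sum_congr rfl fun i _ => ?_
  exact iteratedFDeriv_smul_const_apply (h1 i)

theorem iteratedFDeriv_homField_smul (K : Fin (Module.finrank ℝ V) → 𝓢(Euc n, ℝ)) {l : ℕ}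
    (hl : k < l + n) {t : ℝ} (ht : 0 < t) {x : Euc n} (hx : x ≠ 0) :
    iteratedFDeriv ℝ l (homField n k K) (t • x) =
      (t ^ ((k : ℤ) - (n : ℤ) - (l : ℤ))) • iteratedFDeriv ℝ l (homField n k K) x := by
  rw [iteratedFDeriv_homField K l hx, iteratedFDeriv_homField K l (smul_ne_zero ht.ne' hx),
    Finset.smul_sum]
  refine Finset.sum_congr rfl fun i _ => ?_
  rw [iteratedFDeriv_homKernel_smul (K i) hl ht hx]
  ext m
  simp [mul_smul]

theorem hasDistribADirac_homField (hn : 1 ≤ n) (hk : 1 ≤ k) {A : CoeffOp n k V W} {w : W}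
    {K : Fin (Module.finrank ℝ V) → 𝓢(Euc n, ℝ)}
    (hK : ∀ j x, ∑ I, ∑ l, ⟪stdOrthonormalBasis ℝ W j, A I (stdOrthonormalBasis ℝ V l)⟫ *
      dirDeriv n k I (K l) x = ⟪stdOrthonormalBasis ℝ W j, w⟫ * annularKernel x) :
    HasDistribADirac n k A (homField n k K) w := by
  intro φ hφ
  set bW := stdOrthonormalBasis ℝ W
  set bV := stdOrthonormalBasis ℝ V
  have hs : ∀ j, ContDiff ℝ ∞ fun x => ⟪bW j, φ x⟫ := fun j =>
    (innerSL ℝ (bW j)).contDiff.comp hφ.1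
  have hc : ∀ j, HasCompactSupport fun x => ⟪bW j, φ x⟫ := fun j =>
    hφ.2.comp_left (g := fun v => ⟪bW j, v⟫) (inner_zero_right _)
  let Φ : Fin (Module.finrank ℝ W) → 𝓢(Euc n, ℝ) := fun j => (hc j).toSchwartzMap (hs j)
  have hΦ : ∀ I x, dirDeriv n k I φ x = ∑ j, dirDeriv n k I (Φ j) x • bW j := fun I x => by
    rw [← dirDeriv_sum_smul _ _ _ _ _ (fun j => (Φ j).smooth ⊤)]
    congr 1
    funext y
    exact (bW.sum_repr' (φ y)).symm
  have hΦc : ∀ j, HasCompactSupport (Φ j) := hc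
  have hfi : ∀ I l j, Integrable fun x => homKernel n k (K l) x * dirDeriv n k I (Φ j) x :=
    fun I l j => by
      have h := IsTestFun.dirDeriv ⟨(Φ j).smooth ⊤, hΦc j⟩ k I
      simpa [mul_comm] using (locallyIntegrable_homKernel (n := n) hk
        (K l)).integrable_smul_left_of_hasCompactSupport h.1.continuous h.2
  have hfi' : ∀ I l j (s : ℝ), Integrable fun x =>
      Real.exp (n * s) * dirDeriv n k I (K l) (Real.exp s • x) * Φ j x := fun I l j s => by
    refine Continuous.integrable_of_hasCompactSupport ?_ (hΦc j).mul_left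
    have h := (contDiff_dirDeriv ((K l).smooth ⊤) k I).continuous
    have h' := (Φ j).continuous
    fun_prop
  have hexp : ∀ I x, ⟪homField n k K x, LinearMap.adjoint (A I) (dirDeriv n k I φ x)⟫ =
      ∑ j, ∑ l, ⟪bW j, A I (bV l)⟫ * (homKernel n k (K l) x * dirDeriv n k I (Φ j) x) :=
    fun I x => by
      rw [LinearMap.adjoint_inner_right, hΦ, homField]
      simp only [map_sum, map_smul, sum_inner, inner_sum, real_inner_smul_left,
        real_inner_smul_right]
      refine Finset.sum_congr rfl fun j _ => Finset.sum_congr rfl fun l _ => ?_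
      rw [real_inner_comm (bW j)]
      ring
  have h1 : ∀ I, ∫ x, ⟪homField n k K x, LinearMap.adjoint (A I) (dirDeriv n k I φ x)⟫ =
      ∑ j, ∑ l, ⟪bW j, A I (bV l)⟫ * ∫ x, homKernel n k (K l) x * dirDeriv n k I (Φ j) x :=
    fun I => by
      simp only [hexp]
      rw [integral_finsetSum _ fun j _ => integrable_finsetSum _ fun l _ =>
        (hfi I l j).const_mul _]
      refine Finset.sum_congr rfl fun j _ => ?_
      rw [integral_finsetSum _ fun l _ => (hfi I l j).const_mul _]
      simp only [integral_const_mul]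
  have h2 : ∀ j, ∑ I, ∑ l, ⟪bW j, A I (bV l)⟫ *
      ((-1) ^ k * ∫ x, homKernel n k (K l) x * dirDeriv n k I (Φ j) x) =
        ⟪bW j, w⟫ * Φ j 0 := fun j => by
    simp only [integral_homKernel_mul_dirDeriv hn hk _ _ (Φ j) (hΦc j), ← integral_const_mul]
    have hJ := fun I l => (integrable_integral_dirDeriv_comp_smul_mul hn hk (K l) I
      (Φ j) (hΦc j)).const_mul ⟪bW j, A I (bV l)⟫
    simp only [← integral_const_mul] at hJ
    rw [← integral_integral_exp_mul_annularKernel hn (Φ j), ← integral_const_mul]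
    simp only [← integral_const_mul]
    have h3 : ∀ I, ∑ l, ∫ s : ℝ, ∫ x, ⟪bW j, A I (bV l)⟫ *
        (Real.exp (n * s) * dirDeriv n k I (K l) (Real.exp s • x) * Φ j x) =
          ∫ s : ℝ, ∑ l, ∫ x, ⟪bW j, A I (bV l)⟫ *
            (Real.exp (n * s) * dirDeriv n k I (K l) (Real.exp s • x) * Φ j x) :=
      fun I => (integral_finsetSum _ fun l _ => hJ I l).symm
    simp only [h3]
    rw [← integral_finsetSum _ fun I _ => integrable_finsetSum _ fun l _ => hJ I l]
    refine integral_congr_ae (ae_of_all _ fun s => ?_)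
    have h4 : ∀ I, ∑ l, ∫ x, ⟪bW j, A I (bV l)⟫ *
        (Real.exp (n * s) * dirDeriv n k I (K l) (Real.exp s • x) * Φ j x) =
          ∫ x, ∑ l, ⟪bW j, A I (bV l)⟫ *
            (Real.exp (n * s) * dirDeriv n k I (K l) (Real.exp s • x) * Φ j x) :=
      fun I => (integral_finsetSum _ fun l _ => (hfi' I l j s).const_mul _).symm
    simp only [h4]
    rw [← integral_finsetSum _ fun I _ => integrable_finsetSum _ fun l _ =>
      (hfi' I l j s).const_mul _]
    refine integral_congr_ae (ae_of_all _ fun x => ?_)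
    simp only []
    rw [show ⟪bW j, w⟫ * (Real.exp (n * s) * annularKernel (Real.exp s • x) * Φ j x) =
      Real.exp (n * s) * (⟪bW j, w⟫ * annularKernel (Real.exp s • x)) * Φ j x by ring, ← hK]
    simp only [Finset.mul_sum, Finset.sum_mul]
    refine Finset.sum_congr rfl fun I _ => Finset.sum_congr rfl fun l _ => by ring
  simp only [h1]
  rw [Finset.sum_comm, Finset.mul_sum, ← bW.sum_inner_mul_inner w (φ 0)]
  refine Finset.sum_congr rfl fun j _ => ?_
  rw [real_inner_comm (bW j) w]
  refine Eq.trans ?_ (h2 j)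
  simp only [Finset.mul_sum]
  refine Finset.sum_congr rfl fun I _ => Finset.sum_congr rfl fun l _ => by ring

end FundamentalSolution

theorem symbolMap_smul {V W : Type*}
    [NormedAddCommGroup V] [InnerProductSpace ℝ V] [NormedAddCommGroup W] [InnerProductSpace ℝ W]
    (n k : ℕ) (A : CoeffOp n k V W) (t : ℝ) (ξ : Euc n) :
    symbolMap n k A (t • ξ) = t ^ k • symbolMap n k A ξ := by
  simp [symbolMap, Finset.prod_mul_distrib, Finset.smul_sum, mul_smul]

theorem exists_ne_zero_of_not_isCanceling {n k : ℕ} {V W : Type*}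
    [NormedAddCommGroup V] [InnerProductSpace ℝ V] [NormedAddCommGroup W] [InnerProductSpace ℝ W]
    {A : CoeffOp n k V W} (h : ¬ IsCanceling n k A) :
    ∃ w ≠ 0, ∀ ξ ≠ 0, w ∈ LinearMap.range (symbolMap n k A ξ) := by
  contrapose! h
  refine Set.eq_singleton_iff_unique_mem.2 ⟨by simp, fun w hw => ?_⟩
  by_contra hw0
  obtain ⟨ξ, hξ, hwξ⟩ := h w hw0
  have hξ' := norm_ne_zero_iff.2 hξ
  have h1 : (‖ξ‖⁻¹ • ξ) ∈ sphere (0 : Euc n) 1 := by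
    simp [norm_smul, hξ']
  obtain ⟨v, hv⟩ := Set.mem_iInter₂.1 hw _ h1
  refine hwξ ⟨‖ξ‖⁻¹ ^ k • v, ?_⟩
  rw [← hv, symbolMap_smul, LinearMap.smul_apply, map_smul]

/-- Lemma 2.5: an elliptic `𝒜` is canceling iff whenever
`𝒜 u = δ₀ w` has a solution `u ∈ BV^𝒜_loc` then `w = 0`; moreover, if `𝒜` is elliptic
and non-canceling, then `𝒜 u = δ₀ w` has, for some `w ≠ 0`, a solution `u_h ∈ BV^𝒜_loc`
smooth away from `0` with `D^l u_h` being `(k-n-l)`-homogeneous for `l ≥ max{0, k-n+1}`. -/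
theorem statement12 (n k : ℕ) (hn : 1 ≤ n) (hk : 1 ≤ k) {V W : Type*}
    [NormedAddCommGroup V] [InnerProductSpace ℝ V] [FiniteDimensional ℝ V]
    [NormedAddCommGroup W] [InnerProductSpace ℝ W] [FiniteDimensional ℝ W]
    (A : CoeffOp n k V W) (hA : IsSymmetricOp n k A) (hell : IsElliptic n k A) :
    (IsCanceling n k A ↔
      ∀ (w : W) (u : Euc n → V), LocallyIntegrable u volume →
        HasDistribADirac n k A u w → w = 0) ∧
    (¬ IsCanceling n k A →
      ∃ (w : W) (uh : Euc n → V), w ≠ 0 ∧ LocallyIntegrable uh volume ∧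
        HasDistribADirac n k A uh w ∧ ContDiffOn ℝ (⊤ : ℕ∞) uh {x : Euc n | x ≠ 0} ∧
        ∀ l : ℕ, k < l + n → ∀ t : ℝ, 0 < t → ∀ x : Euc n, x ≠ 0 →
          iteratedFDeriv ℝ l uh (t • x) =
            (t ^ ((k : ℤ) - (n : ℤ) - (l : ℤ))) • iteratedFDeriv ℝ l uh x) := by
  have hnc : ¬ IsCanceling n k A →
      ∃ (w : W) (uh : Euc n → V), w ≠ 0 ∧ LocallyIntegrable uh volume ∧
        HasDistribADirac n k A uh w ∧ ContDiffOn ℝ (⊤ : ℕ∞) uh {x : Euc n | x ≠ 0} ∧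
        ∀ l : ℕ, k < l + n → ∀ t : ℝ, 0 < t → ∀ x : Euc n, x ≠ 0 →
          iteratedFDeriv ℝ l uh (t • x) =
            (t ^ ((k : ℤ) - (n : ℤ) - (l : ℤ))) • iteratedFDeriv ℝ l uh x := fun h => by
    obtain ⟨w, hw0, hw⟩ := exists_ne_zero_of_not_isCanceling h
    obtain ⟨K, hK⟩ := exists_schwartz_sum_dirDeriv_eq_annularKernel hell hw
    exact ⟨w, homField n k K, hw0, locallyIntegrable_homField hk K,
      hasDistribADirac_homField hn hk hK, contDiffOn_homField K,
      fun l hl t ht x hx => iteratedFDeriv_homField_smul K hl ht hx⟩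
  refine ⟨⟨fun hcan w u hu h => ?_, fun h => ?_⟩, hnc⟩
  · have hw : w ∈ ⋂ ξ ∈ sphere (0 : Euc n) 1,
        (LinearMap.range (symbolMap n k A ξ) : Set W) :=
      Set.mem_iInter₂.2 fun ξ hξ =>
        h.mem_range_symbolMap hell hu (ne_zero_of_mem_unit_sphere ⟨ξ, hξ⟩)
    rw [hcan] at hw
    exact hw
  · by_contra hcan
    obtain ⟨w, uh, hw0, hu, h1, -, -⟩ := hnc hcan
    exact hw0 (h w uh hu h1)
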